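/- arXiv:2408.04481 — 2 statements merged into one kernel-verified Lean document; each statement's English description precedes it below -/
import Mathlib

section
/- Let p be a regular prime (p odd and p does not divide the class number of Q(ζ_p)), and let i be an even integer with 2 ≤ i ≤ p-3 (so i is not divisible by p-1). Then the element θ = ∏_{a=1}^{p-1} (1 - ζ_p^a)^{a^i} of K = Q(ζ_p) is not a p-th power in K^×. -/
open NumberField Polynomial


namespace Stmt16
open Finset

lemma sum_half {M : Type*} [AddCommMonoid M] (p r : ℕ) [NeZero p] (hpr : p = 2 * r + 1) (F : ZMod p → M) :
    ∑ c, F c = F 0 + ∑ j : Fin r, (F ((j : ℕ) + 1 : ℕ) + F (-((j : ℕ) + 1 : ℕ))) := by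
  subst hpr
  have h1 : ∑ c : ZMod (2 * r + 1), F c = ∑ i ∈ Finset.range (2 * r + 1), F ((i : ℕ) : ZMod (2 * r + 1)) := by
    symm
    apply Finset.sum_bij (fun i _ => ((i : ℕ) : ZMod (2 * r + 1)))
    · simp
    · intro a ha b hb hab
      simp only [Finset.mem_range] at ha hb
      have := congrArg ZMod.val hab
      rwa [ZMod.val_natCast_of_lt ha, ZMod.val_natCast_of_lt hb] at this
    · intro b _
      exact ⟨b.val, by simpa using ZMod.val_lt b, by simp⟩
    · simp
  have e : 2 * r = r + r := by ring
  rw [h1, Finset.sum_range_succ', add_comm, Nat.cast_zero]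
  congr 1
  rw [Finset.sum_add_distrib]
  have h2 : ∑ k ∈ range (2 * r), F ((k + 1 : ℕ) : ZMod (2 * r + 1)) = ∑ k ∈ range (r + r), F ((k + 1 : ℕ) : ZMod (2 * r + 1)) := Finset.sum_congr (by rw [e]) (fun _ _ => rfl)
  rw [h2, Finset.sum_range_add]
  congr 1
  · rw [Finset.sum_range]
  · rw [← Finset.sum_range_reflect, Finset.sum_range]
    apply Finset.sum_congr rfl
    intro i _
    congr 1
    rw [eq_neg_iff_add_eq_zero, ← Nat.cast_add]
    have : (r + (r - 1 - (i : ℕ)) + 1 + ((i : ℕ) + 1)) = 2 * r + 1 := by omega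
    rw [this]
    exact ZMod.natCast_self _

lemma card_sign (p r : ℕ) [Fact p.Prime] (hpr : p = 2 * r + 1) (hr : 0 < r) (ε : ℂ) (hε : ε = 1 ∨ ε = -1) :
    Fintype.card {χ : DirichletCharacter ℂ p // χ (-1) = ε} = r := by
  classical
  have hp2 : 2 < p := by omega
  have hne : (-1 : ZMod p) ≠ 1 := by
    have : Fact (2 < p) := ⟨hp2⟩
    exact ZMod.neg_one_ne_one
  have h0 := DirichletCharacter.sum_characters_eq_zero ℂ hne
  have hc : Fintype.card (DirichletCharacter ℂ p) = 2 * r := by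
    have := DirichletCharacter.card_eq_totient_of_hasEnoughRootsOfUnity ℂ p
    rw [Nat.card_eq_fintype_card, Nat.totient_prime Fact.out] at this
    omega
  have hval : ∀ χ : DirichletCharacter ℂ p, χ (-1) = 1 ∨ χ (-1) = -1 := by
    intro χ
    exact (DirichletCharacter.even_or_odd χ)
  have h1 : ∀ χ : DirichletCharacter ℂ p, (if χ (-1) = ε then (2:ℂ) else 0) = 1 + ε * χ (-1) := by
    intro χ
    have e : (1 : ℂ) ≠ -1 := by norm_num
    rcases hε with rfl | rfl <;> rcases hval χ with h | h <;> rw [h] <;> norm_num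
  have h2 : ∑ χ : DirichletCharacter ℂ p, (if χ (-1) = ε then (2:ℂ) else 0) = 2 * r := by
    simp_rw [h1, Finset.sum_add_distrib, ← Finset.mul_sum, h0]
    simp [hc]
  rw [← Finset.sum_filter, Finset.sum_const, nsmul_eq_mul] at h2
  rw [Fintype.card_subtype]
  have : ((#{χ : DirichletCharacter ℂ p | χ (-1) = ε} : ℕ) : ℂ) = r := by
    linear_combination h2 / 2
  exact_mod_cast this

lemma star_apply {p : ℕ} [Fact p.Prime] (χ : DirichletCharacter ℂ p) (a : ZMod p) :
    (starRingEnd ℂ) (χ a) = χ⁻¹ a := by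
  rw [← MulChar.star_eq_inv, MulChar.star_apply]; rfl

/-- The half-system group determinant. -/
lemma det_half (p r : ℕ) [Fact p.Prime] (hpr : p = 2 * r + 1) (hr : 0 < r) (ε : ℂ) (hε : ε = 1 ∨ ε = -1)
    (g : ZMod p → ℂ) :
    ‖(Matrix.of fun i j : Fin r => g (((i : ℕ) + 1 : ℕ) * ((j : ℕ) + 1 : ℕ)) +
        ε * g (-(((i : ℕ) + 1 : ℕ) * ((j : ℕ) + 1 : ℕ)))).det‖ =
      ∏ χ : {χ : DirichletCharacter ℂ p // χ (-1) = ε}, ‖∑ c, g c * χ.1 c‖ := by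
  classical
  let e : Fin r ≃ {χ : DirichletCharacter ℂ p // χ (-1) = ε} :=
    Fintype.equivOfCardEq (by rw [card_sign p r hpr hr ε hε, Fintype.card_fin])
  set h : Fin r → ZMod p := fun j => (((j : ℕ) + 1 : ℕ) : ZMod p) with hh
  have hε2 : ε * ε = 1 := by rcases hε with rfl | rfl <;> norm_num
  have hunit : ∀ j, h j ≠ 0 := by
    intro j hj
    rw [hh] at hj
    simp only [ZMod.natCast_eq_zero_iff] at hj
    have := Nat.le_of_dvd (by omega) hj
    omega
  have hneg : ∀ (k : Fin r) (a : ZMod p), (e k).1 (-a) = ε * (e k).1 a := by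
    intro k a
    have : -a = -1 * a := by ring
    rw [this, map_mul, (e k).2]
  let X : Matrix (Fin r) (Fin r) ℂ := Matrix.of fun j k => (e k).1 (h j)
  let A : Matrix (Fin r) (Fin r) ℂ := Matrix.of fun i j => g (h i * h j) + ε * g (-(h i * h j))
  let d : Fin r → ℂ := fun k => ∑ c, g c * (e k).1 c
  let Y : Matrix (Fin r) (Fin r) ℂ := X.map (starRingEnd ℂ)
  have hA : A * X = Y * Matrix.diagonal d := by
    ext i k
    rw [Matrix.mul_diagonal, Matrix.mul_apply]
    simp only [A, X, Y, d, Matrix.of_apply, Matrix.map_apply]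
    have h1 : ∑ c, g (h i * c) * (e k).1 c = ∑ j, (g (h i * h j) + ε * g (-(h i * h j))) * (e k).1 (h j) := by
      rw [sum_half p r hpr]
      rw [MulChar.map_zero, mul_zero, zero_add]
      apply Finset.sum_congr rfl
      intro j _
      change g (h i * h j) * _ + g (h i * -h j) * (e k).1 (- h j) = _
      rw [hneg, mul_neg]
      ring
    rw [← h1, star_apply, Finset.mul_sum]
    let m : ZMod p ≃ ZMod p := Equiv.mulLeft₀ (h i) (hunit i)
    rw [← Equiv.sum_comp m (fun c => (e k).1⁻¹ (h i) * (g c * (e k).1 c))]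
    apply Finset.sum_congr rfl
    intro c _
    have hm : m c = h i * c := rfl
    rw [hm, map_mul]
    have : (e k).1⁻¹ (h i) * (e k).1 (h i) = 1 := by
      rw [← MulChar.mul_apply, inv_mul_cancel, MulChar.one_apply (isUnit_iff_ne_zero.mpr (hunit i))]
    linear_combination (-(g (h i * c) * (e k).1 c)) * this
  have hX : X.det ≠ 0 := by
    have h2 : Y.transpose * X = Matrix.diagonal (fun _ => (r : ℂ)) := by
      ext k l
      rw [Matrix.mul_apply]
      simp only [X, Y, Matrix.of_apply, Matrix.map_apply, Matrix.transpose_apply, star_apply]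
      have h3 : ∑ c, ((e k).1⁻¹ * (e l).1) c = 2 * ∑ j, (e k).1⁻¹ (h j) * (e l).1 (h j) := by
        rw [sum_half p r hpr, MulChar.map_zero, zero_add, Finset.mul_sum]
        apply Finset.sum_congr rfl
        intro j _
        change ((e k).1⁻¹ * (e l).1) (h j) + ((e k).1⁻¹ * (e l).1) (-h j) = _
        simp only [MulChar.mul_apply]
        have : (e k).1⁻¹ (-h j) = ε * (e k).1⁻¹ (h j) := by
          rw [← star_apply, hneg, map_mul, star_apply]
          rcases hε with h | h <;> simp [h]
        rw [this, hneg]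
        linear_combination ((e k).1⁻¹ (h j) * (e l).1 (h j)) * hε2
      by_cases hkl : k = l
      · subst hkl
        rw [Matrix.diagonal_apply_eq]
        have : ∀ j, (e k).1⁻¹ (h j) * (e k).1 (h j) = 1 := by
          intro j
          rw [← MulChar.mul_apply, inv_mul_cancel, MulChar.one_apply (isUnit_iff_ne_zero.mpr (hunit j))]
        simp [this]
      · rw [Matrix.diagonal_apply_ne _ hkl]
        have : (e k).1⁻¹ * (e l).1 ≠ 1 := by
          intro h4
          apply hkl
          apply e.injective
          apply Subtype.ext
          exact (inv_mul_eq_one.mp h4)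
        rw [MulChar.sum_eq_zero_of_ne_one this] at h3
        simpa using h3.symm
    intro h0
    have := congrArg Matrix.det h2
    rw [Matrix.det_mul, h0, mul_zero, Matrix.det_diagonal] at this
    have hr0 : (r : ℂ) ≠ 0 := by exact_mod_cast hr.ne'
    exact (Finset.prod_ne_zero_iff.mpr fun _ _ => hr0) this.symm
  have hYX : ‖Y.det‖ = ‖X.det‖ := by
    have : Y.det = (starRingEnd ℂ) X.det := by
      rw [RingHom.map_det]; rfl
    rw [this, Complex.norm_conj]
  have := congrArg (fun M => ‖Matrix.det M‖) hA
  simp only [Matrix.det_mul, norm_mul, hYX, Matrix.det_diagonal, norm_prod] at this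
  have h5 : ‖A.det‖ = ∏ k, ‖d k‖ := by
    have hXn : ‖X.det‖ ≠ 0 := norm_ne_zero_iff.mpr hX
    apply mul_right_cancel₀ hXn
    rw [this, mul_comm]
  rw [← Equiv.prod_comp e]
  exact h5

end Stmt16


namespace Stmt16
open Finset

/-- A determinant of size `r`, all of whose rows are congruent mod `p` to multiples of the row `i₀`. -/
lemma dvd_det_of_rank_one {r : ℕ} (p : ℤ) (A : Matrix (Fin r) (Fin r) ℤ) (i₀ : Fin r)
    (c : Fin r → ℤ) (hA : ∀ i j, p ∣ A i j - c i * A i₀ j) : p ^ (r - 1) ∣ A.det := by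
  classical
  choose B hB using hA
  let v : Fin r → ℤ := fun i => if i = i₀ then 1 else p
  let C : Matrix (Fin r) (Fin r) ℤ := Matrix.of fun i j => if i = i₀ then A i₀ j else B i j
  have h1 : A.det = (Matrix.of fun i j => v i * C i j).det := by
    apply Matrix.det_eq_of_forall_row_eq_smul_add_const (fun i => if i = i₀ then 0 else c i) i₀
    · simp
    · intro i j
      by_cases hi : i = i₀
      · subst hi; simp [v, C]
      · have := hB i j
        simp only [v, C, Matrix.of_apply, if_neg hi, if_true, one_mul]
        linarith
  rw [h1, Matrix.det_mul_column]
  apply Dvd.dvd.mul_right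
  simp only [v]
  rw [Finset.prod_ite]
  simp [Finset.filter_ne', Finset.card_erase_of_mem]

lemma maillet (p r : ℕ) [Fact p.Prime] (hpr : p = 2 * r + 1) (hr : 0 < r) :
    ∃ m : ℕ, ‖(Matrix.of fun i j : Fin r =>
        ((ZMod.val ((((i : ℕ) + 1 : ℕ) : ZMod p) * (((j : ℕ) + 1 : ℕ) : ZMod p)) : ℕ) : ℂ) +
        (-1) * ((ZMod.val (-((((i : ℕ) + 1 : ℕ) : ZMod p) * (((j : ℕ) + 1 : ℕ) : ZMod p))) : ℕ) : ℂ)).det‖ =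
      (p : ℝ) ^ (r - 1) * m := by
  let A : Matrix (Fin r) (Fin r) ℤ := Matrix.of fun i j =>
        ((ZMod.val ((((i : ℕ) + 1 : ℕ) : ZMod p) * (((j : ℕ) + 1 : ℕ) : ZMod p)) : ℕ) : ℤ) +
        (-1) * ((ZMod.val (-((((i : ℕ) + 1 : ℕ) : ZMod p) * (((j : ℕ) + 1 : ℕ) : ZMod p))) : ℕ) : ℤ)
  have hd : (p : ℤ) ^ (r - 1) ∣ A.det := by
    apply dvd_det_of_rank_one (p : ℤ) A ⟨0, hr⟩ (fun i => (i : ℕ) + 1)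
    intro i j
    rw [← ZMod.intCast_zmod_eq_zero_iff_dvd]
    simp [A]
    ring
  obtain ⟨m, hm⟩ := hd
  refine ⟨m.natAbs, ?_⟩
  have : (Matrix.of fun i j : Fin r =>
        ((ZMod.val ((((i : ℕ) + 1 : ℕ) : ZMod p) * (((j : ℕ) + 1 : ℕ) : ZMod p)) : ℕ) : ℂ) +
        (-1) * ((ZMod.val (-((((i : ℕ) + 1 : ℕ) : ZMod p) * (((j : ℕ) + 1 : ℕ) : ZMod p))) : ℕ) : ℂ)) = (Int.castRingHom ℂ).mapMatrix A := by
    ext i j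
    simp [A]
  rw [this, ← RingHom.map_det, hm]
  simp [Nat.cast_natAbs]

/-- Integrality: the product of the odd first moments is divisible by `p ^ (r - 1)`. -/
lemma prod_odd (p r : ℕ) [Fact p.Prime] (hpr : p = 2 * r + 1) (hr : 0 < r) :
    ∃ m : ℕ, ∏ χ : {χ : DirichletCharacter ℂ p // χ (-1) = -1}, ‖∑ c, (c.val : ℂ) * χ.1 c‖ =
      (p : ℝ) ^ (r - 1) * m := by
  obtain ⟨m, hm⟩ := maillet p r hpr hr
  exact ⟨m, by rw [← hm, ← det_half p r hpr hr (-1) (Or.inr rfl) (fun c => (c.val : ℂ))]⟩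

end Stmt16


namespace Stmt16
open Complex Filter Topology MeasureTheory Asymptotics

lemma slit_aux {z : ℂ} (hz : ‖z‖ = 1) (hz1 : z ≠ 1) {t : ℝ} (ht : 0 ≤ t) :
    (1 - z * ((Real.exp (-t) : ℝ) : ℂ)) ∈ slitPlane := by
  left
  have h1 : z.re < 1 := by
    refine lt_of_le_of_ne (hz ▸ re_le_norm z) ?_
    intro h
    apply hz1
    have h2 : z.im = 0 := by
      have := Complex.sq_norm z
      rw [hz, normSq_apply, h] at this
      nlinarith
    exact Complex.ext (by simpa using h) (by simpa using h2)
  have h3 : 0 < Real.exp (-t) := Real.exp_pos _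
  have h4 : Real.exp (-t) ≤ 1 := Real.exp_le_one_iff.mpr (by linarith)
  simp only [sub_re, one_re, re_mul_ofReal]
  rcases le_or_gt z.re 0 with h | h
  · nlinarith
  · nlinarith

lemma expZeta_one {x : ℝ} (hx0 : 0 < x) (hx1 : x < 1) :
    HurwitzZeta.expZeta (x : UnitAddCircle) 1 = -Complex.log (1 - cexp (2 * Real.pi * I * x)) := by
  set z : ℂ := cexp (2 * Real.pi * I * x) with hzdef
  have hz : ‖z‖ = 1 := by
    have : (2 * Real.pi * I * x : ℂ) = ((2 * Real.pi * x : ℝ) : ℂ) * I := by push_cast; ring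
    rw [hzdef, this, norm_exp_ofReal_mul_I]
  have hz1 : z ≠ 1 := by
    intro h
    rw [hzdef, Complex.exp_eq_one_iff] at h
    obtain ⟨n, hn⟩ := h
    have hpi : (2 * Real.pi * I : ℂ) ≠ 0 := Complex.two_pi_I_ne_zero
    have h2 : (x : ℂ) = n := by
      apply mul_left_cancel₀ hpi
      rw [hn]; ring
    have h3 : x = n := by exact_mod_cast h2
    rw [h3] at hx0 hx1
    have h4 : 0 < n := by exact_mod_cast hx0
    have h5 : n < 1 := by exact_mod_cast hx1
    omega
  have hx : (x : UnitAddCircle) ≠ 0 := by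
    intro h
    have h' := (AddCircle.coe_eq_zero_iff_of_mem_Ico (p := (1:ℝ)) (hp := ⟨one_pos⟩) (a := x) ⟨hx0.le, by simpa using hx1⟩).mp h
    exact hx0.ne' h'
  let F : ℝ → ℂ := fun t => z * ((Real.exp (-t) : ℝ) : ℂ) / (1 - z * ((Real.exp (-t) : ℝ) : ℂ))
  have hne : ∀ t : ℝ, 0 ≤ t → (1 - z * ((Real.exp (-t) : ℝ) : ℂ)) ≠ 0 :=
    fun t ht => slitPlane_ne_zero (slit_aux hz hz1 ht)
  have hcont : ContinuousOn F (Set.Ici 0) := by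
    apply ContinuousOn.div (by fun_prop) (by fun_prop)
    intro t ht
    exact hne t ht
  have hloc : LocallyIntegrableOn F (Set.Ioi 0) :=
    (hcont.mono Set.Ioi_subset_Ici_self).locallyIntegrableOn measurableSet_Ioi
  have hexp0 : Tendsto (fun t : ℝ => ((Real.exp (-t) : ℝ) : ℂ)) atTop (𝓝 0) := by
    have := (continuous_ofReal.tendsto 0).comp Real.tendsto_exp_neg_atTop_nhds_zero
    rwa [ofReal_zero] at this
  have hinf : F =O[atTop] fun t => Real.exp (-1 * t) := by
    have h1 : (fun t : ℝ => z / (1 - z * ((Real.exp (-t) : ℝ) : ℂ))) =O[atTop] fun _ => (1 : ℝ) := by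
      have : Tendsto (fun t : ℝ => z / (1 - z * ((Real.exp (-t) : ℝ) : ℂ))) atTop (𝓝 (z / (1 - z * 0))) := by
        apply Tendsto.div tendsto_const_nhds (tendsto_const_nhds.sub (tendsto_const_nhds.mul hexp0))
        simp
      exact this.isBigO_one ℝ
    have h2 : (fun t : ℝ => ((Real.exp (-t) : ℝ) : ℂ)) =O[atTop] fun t => Real.exp (-1 * t) := by
      apply IsBigO.of_bound 1
      filter_upwards with t
      rw [Complex.norm_real]
      simp
    have h3 := h1.mul h2
    simp only [one_mul] at h3
    refine h3.congr_left ?_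
    intro t
    simp only [F]; ring
  have hzero : F =O[𝓝[>] 0] fun t => t ^ (-(0:ℝ)) := by
    have : Tendsto F (𝓝[>] 0) (𝓝 (F 0)) :=
      ((hcont 0 (by simp)).mono Set.Ioi_subset_Ici_self)
    simpa using this.isBigO_one ℝ
  have hdiff : DifferentiableAt ℂ (mellin F) 1 :=
    mellin_differentiableAt_of_isBigO_rpow_exp one_pos hloc hinf hzero (by simp)
  have hconv : MellinConvergent F 1 :=
    mellinConvergent_of_isBigO_rpow_exp one_pos hloc hinf hzero (by simp)
  have hIntg : IntegrableOn F (Set.Ioi 0) := by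
    simpa [MellinConvergent] using hconv
  -- value of the Mellin transform at one
  have hval : mellin F 1 = -Complex.log (1 - z) := by
    have hd : ∀ t ∈ Set.Ici (0:ℝ), HasDerivAt (fun t : ℝ => Complex.log (1 - z * ((Real.exp (-t) : ℝ) : ℂ))) (F t) t := by
      intro t ht
      have h1 : HasDerivAt (fun t : ℝ => ((Real.exp (-t) : ℝ) : ℂ)) ((-Real.exp (-t) : ℝ) : ℂ) t := by
        apply HasDerivAt.ofReal_comp
        simpa using (hasDerivAt_neg t).exp
      have h2 := ((h1.const_mul z).const_sub 1).clog_real (slit_aux hz hz1 ht)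
      convert h2 using 1
      simp only [F]; push_cast; ring
    have := integral_Ioi_of_hasDerivAt_of_tendsto (a := 0) (f' := F) (m := 0)
      (f := fun t : ℝ => Complex.log (1 - z * ((Real.exp (-t) : ℝ) : ℂ)))
      (hd 0 (by simp)).continuousAt.continuousWithinAt (fun t ht => hd t (Set.Ioi_subset_Ici_self ht)) hIntg ?_
    · simp only [mellin]
      simp only [sub_self, cpow_zero, one_smul]
      rw [this]; simp
    · have h1 : Tendsto (fun t : ℝ => 1 - z * ((Real.exp (-t) : ℝ) : ℂ)) atTop (𝓝 1) := by
        simpa using (tendsto_const_nhds (x := (1:ℂ))).sub (tendsto_const_nhds (x := z) |>.mul hexp0)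
      have := h1.clog (by simp)
      simpa using this
  -- identity for s > 1
  have hid : ∀ s : ℂ, 1 < s.re → mellin F s = Gamma s * HurwitzZeta.expZeta (x : UnitAddCircle) s := by
    intro s hs
    have hs0 : s ≠ 0 := by rintro rfl; norm_num at hs
    have h1 := HurwitzZeta.hasSum_expZeta_of_one_lt_re x hs
    have h2 : HasSum (fun n : ℕ => z ^ (n + 1) / ((n + 1 : ℕ) : ℂ) ^ s) (HurwitzZeta.expZeta (x : UnitAddCircle) s) := by
      have := (hasSum_nat_add_iff' 1).mpr h1
      simp only [Finset.sum_range_one, Nat.cast_zero, zero_cpow hs0, div_zero, sub_zero] at this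
      refine this.congr_fun ?_
      intro n
      rw [hzdef, ← Complex.exp_nat_mul]
      congr 2; push_cast; ring
    have h3 : HasSum (fun n : ℕ => Gamma s * z ^ (n + 1) / (((n : ℝ) + 1 : ℝ) : ℂ) ^ s) (mellin F s) := by
      apply hasSum_mellin (a := fun n : ℕ => z ^ (n + 1)) (p := fun n : ℕ => (n : ℝ) + 1)
      · intro n; right; positivity
      · linarith
      · intro t ht
        have ht' : (0:ℝ) < t := ht
        have hlt : ‖z * ((Real.exp (-t) : ℝ) : ℂ)‖ < 1 := by
          rw [norm_mul, hz, one_mul, Complex.norm_real, Real.norm_eq_abs, Real.abs_exp]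
          exact Real.exp_lt_one_iff.mpr (by linarith)
        have := (hasSum_geometric_of_norm_lt_one hlt).mul_left (z * ((Real.exp (-t) : ℝ) : ℂ))
        rw [← div_eq_mul_inv] at this
        refine this.congr_fun ?_
        intro n
        rw [← pow_succ', mul_pow, ← ofReal_pow, ← Real.exp_nat_mul]
        congr 3; push_cast; ring
      · simp only [norm_pow, hz, one_pow]
        have := (summable_nat_add_iff 1).mpr (Real.summable_one_div_nat_rpow.mpr hs)
        simpa using this
    rw [← h3.tsum_eq, ← h2.tsum_eq, ← tsum_mul_left]
    congr 1; ext n; push_cast; ring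
  -- pass to the limit
  have hseq : Tendsto (fun s : ℝ => (s : ℂ)) (𝓝[>] 1) (𝓝 1) :=
    (continuous_ofReal.tendsto 1).mono_left nhdsWithin_le_nhds
  have l1 : Tendsto (fun s : ℝ => mellin F s) (𝓝[>] 1) (𝓝 (mellin F 1)) :=
    hdiff.continuousAt.tendsto.comp hseq
  have l2 : Tendsto (fun s : ℝ => Gamma s * HurwitzZeta.expZeta (x : UnitAddCircle) s) (𝓝[>] 1)
      (𝓝 (Gamma 1 * HurwitzZeta.expZeta (x : UnitAddCircle) 1)) := by
    apply Tendsto.mul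
    · exact (Complex.differentiableAt_Gamma_one.continuousAt.tendsto.comp hseq)
    · exact (HurwitzZeta.differentiable_expZeta_of_ne_zero hx 1).continuousAt.tendsto.comp hseq
  have heq : (fun s : ℝ => mellin F s) =ᶠ[𝓝[>] 1] fun s : ℝ => Gamma s * HurwitzZeta.expZeta (x : UnitAddCircle) s := by
    filter_upwards [self_mem_nhdsWithin] with s hs
    exact hid s (by simpa using hs)
  have := tendsto_nhds_unique (l1.congr' heq) l2
  rw [Complex.Gamma_one, one_mul, hval] at this
  exact this.symm

lemma expZeta_one' {x : ℝ} (hx0 : 0 < x) (hx1 : x < 1) :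
    HurwitzZeta.expZeta (x : UnitAddCircle) 1 =
      -((Real.log ‖1 - cexp (2 * Real.pi * I * x)‖ : ℝ) : ℂ) - Real.pi * I * (x - 1 / 2) := by
  rw [expZeta_one hx0 hx1]
  have hs : 0 < 2 * Real.sin (Real.pi * x) := by
    have := Real.sin_pos_of_pos_of_lt_pi (x := Real.pi * x) (by positivity) (by nlinarith [Real.pi_pos])
    linarith
  have h1 : 1 - cexp (2 * Real.pi * I * x) =
      ((2 * Real.sin (Real.pi * x) : ℝ) : ℂ) * cexp (((Real.pi * (x - 1 / 2) : ℝ) : ℂ) * I) := by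
    have e1 : (((Real.pi * (x - 1 / 2) : ℝ) : ℂ) * I) = Real.pi * x * I + (-(Real.pi / 2 * I)) := by
      push_cast; ring
    have e2 : (2 * Real.pi * I * x : ℂ) = Real.pi * x * I + Real.pi * x * I := by ring
    rw [e1, e2, Complex.exp_add, Complex.exp_add, Complex.exp_neg, Complex.exp_pi_div_two_mul_I]
    push_cast
    rw [Complex.sin]
    rw [neg_mul, Complex.exp_neg]
    have := Complex.exp_ne_zero (Real.pi * x * I)
    field_simp
  have hn : ‖1 - cexp (2 * Real.pi * I * x)‖ = 2 * Real.sin (Real.pi * x) := by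
    rw [h1, norm_mul, Complex.norm_exp_ofReal_mul_I, Complex.norm_real, mul_one, Real.norm_of_nonneg hs.le]
  rw [hn, h1, Complex.log_ofReal_mul hs (Complex.exp_ne_zero _), Complex.log_exp]
  · push_cast; ring
  · simp; nlinarith [Real.pi_pos]
  · simp; nlinarith [Real.pi_pos]

end Stmt16


namespace Stmt16
open Complex

/-- `log |1 - e(c/p)|`. -/
noncomputable def lam (p : ℕ) [NeZero p] (c : ZMod p) : ℝ := Real.log ‖1 - (ZMod.stdAddChar c : ℂ)‖

lemma lam_neg (p : ℕ) [NeZero p] (c : ZMod p) : lam p (-c) = lam p c := by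
  unfold lam
  rw [AddChar.map_neg_eq_conj, ← Complex.norm_conj (1 - (ZMod.stdAddChar c : ℂ))]
  simp

lemma gauss_norm (p : ℕ) [Fact p.Prime] (χ : DirichletCharacter ℂ p) (hχ : χ ≠ 1) :
    ‖gaussSum χ ZMod.stdAddChar‖ = Real.sqrt p := by
  have h := gaussSum_mul_gaussSum_eq_card hχ (ZMod.isPrimitive_stdAddChar p)
  rw [← star_gaussSum_eq, ZMod.card] at h
  have h2 := congrArg norm h
  rw [norm_mul, norm_star, Complex.norm_natCast] at h2
  rw [← h2, Real.sqrt_mul_self (norm_nonneg _)]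

lemma LFunction_one_formula (p : ℕ) [Fact p.Prime] (χ : DirichletCharacter ℂ p) (hχ : χ ≠ 1) :
    ‖DirichletCharacter.LFunction χ 1‖ * Real.sqrt p =
      ‖∑ c : ZMod p, χ⁻¹ c * (((lam p c : ℝ) : ℂ) + Real.pi * I * (c.val / p - 1 / 2))‖ := by
  have hp : p.Prime := Fact.out
  have hinv : χ⁻¹ ≠ 1 := by simpa using hχ
  have hprim : (χ⁻¹).IsPrimitive := by
    rw [DirichletCharacter.isPrimitive_def]
    rcases (Nat.dvd_prime hp).mp (DirichletCharacter.conductor_dvd_level χ⁻¹) with h | h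
    · exact absurd (DirichletCharacter.eq_one_iff_conductor_eq_one.mpr h) hinv
    · exact h
  have h1 := ZMod.LFunction_dft (⇑χ⁻¹) (s := 1) (Or.inl (MulChar.map_zero _))
  have h2 : ZMod.dft (⇑χ⁻¹) = fun k => (χ (-1) * gaussSum χ⁻¹ ZMod.stdAddChar) * χ k := by
    ext k
    rw [hprim.fourierTransform_eq_inv_mul_gaussSum, inv_inv, ← neg_one_mul, map_mul]
    ring
  have h3 : ZMod.LFunction (ZMod.dft (⇑χ⁻¹)) 1 =
      (χ (-1) * gaussSum χ⁻¹ ZMod.stdAddChar) * DirichletCharacter.LFunction χ 1 := by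
    rw [h2, DirichletCharacter.LFunction, ZMod.LFunction, ZMod.LFunction, Finset.mul_sum, Finset.mul_sum,
      Finset.mul_sum]
    apply Finset.sum_congr rfl
    intros; ring
  have hm1 : ∀ ψ : DirichletCharacter ℂ p, ‖ψ (-1)‖ = 1 := by
    intro ψ
    rcases DirichletCharacter.even_or_odd ψ with h | h
    · rw [show ψ (-1) = 1 from h]; simp
    · rw [show ψ (-1) = -1 from h]; simp
  have h4 : ∑ j : ZMod p, χ⁻¹ j * HurwitzZeta.expZeta (ZMod.toAddCircle (-j)) 1 =
      -χ⁻¹ (-1) * ∑ c : ZMod p, χ⁻¹ c * (((lam p c : ℝ) : ℂ) + Real.pi * I * (c.val / p - 1 / 2)) := by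
    rw [← Equiv.sum_comp (Equiv.neg (ZMod p)), Finset.mul_sum]
    apply Finset.sum_congr rfl
    intro c _
    simp only [Equiv.neg_apply, neg_neg]
    have : -c = -1 * c := by ring
    rw [this, map_mul]
    by_cases hc : c = 0
    · subst hc; have h0 : χ⁻¹ (0:ZMod p) = 0 := MulChar.map_zero _; simp [h0]
    have hcpos : 0 < c.val := Nat.pos_of_ne_zero (by rwa [Ne, ZMod.val_eq_zero])
    have hclt : c.val < p := ZMod.val_lt c
    have hppos : (0:ℝ) < p := by exact_mod_cast hp.pos
    rw [ZMod.toAddCircle_apply, expZeta_one' (by positivity) (by rw [div_lt_one hppos]; exact_mod_cast hclt)]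
    have : lam p c = Real.log ‖1 - cexp (2 * Real.pi * I * ((c.val / p : ℝ) : ℂ))‖ := by
      rw [lam, ZMod.stdAddChar_apply, ZMod.toCircle_apply]
      congr 4
      push_cast; ring
    rw [this]
    push_cast
    ring
  rw [h3, h4] at h1
  have h5 := congrArg norm h1
  simp only [norm_mul, norm_neg, hm1, one_mul, gauss_norm p _ hinv] at h5
  rw [mul_comm]
  exact h5

lemma LFunction_one_even (p : ℕ) [Fact p.Prime] (χ : DirichletCharacter ℂ p) (hχ : χ ≠ 1) (h1 : χ (-1) = 1) :
    ‖DirichletCharacter.LFunction χ 1‖ * Real.sqrt p = ‖∑ c : ZMod p, ((lam p c : ℝ) : ℂ) * χ⁻¹ c‖ := by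
  rw [LFunction_one_formula p χ hχ]
  congr 1
  simp only [mul_add, Finset.sum_add_distrib]
  have hz : ∑ c : ZMod p, χ⁻¹ c * (Real.pi * I * ((c.val : ℂ) / p - 1 / 2)) = 0 := by
    have hpp : (p : ℂ) ≠ 0 := by exact_mod_cast (Fact.out : p.Prime).ne_zero
    have hh : χ⁻¹ (-1) = 1 := by rw [← star_apply, h1]; simp
    rw [← self_eq_neg, ← Finset.sum_neg_distrib]
    conv_lhs => rw [← Equiv.sum_comp (Equiv.neg (ZMod p))]
    apply Finset.sum_congr rfl
    intro c _
    simp only [Equiv.neg_apply]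
    by_cases hc : c = 0
    · subst hc; have h0 : χ⁻¹ (0:ZMod p) = 0 := MulChar.map_zero _; simp [h0]
    have e : -c = -1 * c := by ring
    have e2 : χ⁻¹ (-c) = χ⁻¹ c := by rw [e, map_mul, hh, one_mul]
    rw [e2, ZMod.neg_val, if_neg hc, Nat.cast_sub (ZMod.val_lt c).le]
    field_simp
    ring
  rw [hz, add_zero]
  exact Finset.sum_congr rfl fun _ _ => mul_comm _ _

lemma LFunction_one_odd (p : ℕ) [Fact p.Prime] (χ : DirichletCharacter ℂ p) (hχ : χ ≠ 1) (h1 : χ (-1) = -1) :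
    ‖DirichletCharacter.LFunction χ 1‖ * Real.sqrt p = Real.pi / p * ‖∑ c : ZMod p, (c.val : ℂ) * χ⁻¹ c‖ := by
  rw [LFunction_one_formula p χ hχ]
  have hinv : χ⁻¹ ≠ 1 := by simpa using hχ
  have hh : χ⁻¹ (-1) = -1 := by rw [← star_apply, h1]; simp
  have hz : ∑ c : ZMod p, χ⁻¹ c * ((lam p c : ℝ) : ℂ) = 0 := by
    rw [← self_eq_neg, ← Finset.sum_neg_distrib]
    conv_lhs => rw [← Equiv.sum_comp (Equiv.neg (ZMod p))]
    apply Finset.sum_congr rfl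
    intro c _
    simp only [Equiv.neg_apply]
    have e : -c = -1 * c := by ring
    have e2 : χ⁻¹ (-c) = -χ⁻¹ c := by rw [e, map_mul, hh, neg_one_mul]
    rw [e2, lam_neg, neg_mul]
  have h2 : ∑ c : ZMod p, χ⁻¹ c * (((lam p c : ℝ) : ℂ) + Real.pi * I * (c.val / p - 1 / 2)) =
      (Real.pi / p * I) * ∑ c : ZMod p, (c.val : ℂ) * χ⁻¹ c := by
    have h3 : ∀ c : ZMod p, χ⁻¹ c * (((lam p c : ℝ) : ℂ) + Real.pi * I * (c.val / p - 1 / 2)) =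
        χ⁻¹ c * ((lam p c : ℝ) : ℂ) + (Real.pi / p * I) * ((c.val : ℂ) * χ⁻¹ c) - (Real.pi * I / 2) * χ⁻¹ c := by
      intro c; ring
    simp only [h3, Finset.sum_sub_distrib, Finset.sum_add_distrib, ← Finset.mul_sum, hz,
      MulChar.sum_eq_zero_of_ne_one hinv]
    ring
  rw [h2, norm_mul]
  congr 1
  simp [abs_of_pos Real.pi_pos]

end Stmt16


namespace Stmt16
open Filter Topology

/-- `N(I)^{-s}`. -/
noncomputable def nf (K : Type) [Field K] [NumberField K] (s : ℝ) (I : Ideal (𝓞 K)) : ℝ :=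
  (Ideal.absNorm I : ℝ) ^ (-s)

section
variable (K : Type) [Field K] [NumberField K]

lemma count_bigO : (fun n : ℕ ↦ ∑ k ∈ Finset.Icc 1 n, (Nat.card {I : Ideal (𝓞 K) // Ideal.absNorm I = k} : ℝ))
    =O[atTop] fun n ↦ (n : ℝ) ^ (1:ℝ) := by
  have h : Tendsto (fun n : ℕ => (∑ k ∈ Finset.Icc 1 n, (Nat.card {I : Ideal (𝓞 K) // Ideal.absNorm I = k} : ℝ)) / n)
      atTop (𝓝 (dedekindZeta_residue K)) := by
    refine ((NumberField.Ideal.tendsto_norm_le_div_atTop₀ K).comp tendsto_natCast_atTop_atTop).congr fun n ↦ ?_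
    simp only [Function.comp_apply, Nat.cast_le, ← Nat.cast_sum]
    congr
    rw [← add_left_inj 1, ← Ideal.card_norm_le_eq_card_norm_le_add_one,
      show Finset.Icc 1 n = Finset.Ioc 0 n from Finset.Icc_succ_left_eq_Ioc _ _,
      show 1 = Nat.card {I : Ideal (𝓞 K) // Ideal.absNorm I = 0} by simp [Ideal.absNorm_eq_zero_iff],
      Finset.sum_Ioc_add_eq_sum_Icc (n.zero_le),
      ← Finset.card_preimage_eq_sum_card_image_eq (fun k _ ↦ Ideal.finite_setOfPred_absNorm_eq k)]
    simp [Set.coe_eq_subtype]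
  have h2 := h.isBigO_one ℝ
  have h3 := h2.mul (Asymptotics.isBigO_refl (fun n : ℕ => (n:ℝ)) atTop)
  refine (h3.congr' ?_ ?_)
  · filter_upwards [eventually_ne_atTop 0] with n hn
    have : (n:ℝ) ≠ 0 := by exact_mod_cast hn
    field_simp
  · filter_upwards with n
    simp

lemma nf_summable_and (s : ℝ) (hs : 1 < s) :
    Summable (nf K s) ∧ dedekindZeta K s = ((∑' I, nf K s I : ℝ) : ℂ) := by
  have h1 : LSeriesSummable (fun n ↦ ((Nat.card {I : Ideal (𝓞 K) // Ideal.absNorm I = n} : ℝ) : ℂ)) (s:ℂ) :=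
    LSeriesSummable_of_sum_norm_bigO_and_nonneg (count_bigO K) (fun n => by positivity) zero_le_one (by simpa using hs)
  set T : ℕ → ℝ := fun n => (Nat.card {I : Ideal (𝓞 K) // Ideal.absNorm I = n} : ℝ) * (n:ℝ)^(-s) with hT
  have h2 : ∀ n, LSeries.term (fun n ↦ ((Nat.card {I : Ideal (𝓞 K) // Ideal.absNorm I = n} : ℝ) : ℂ)) (s:ℂ) n = ((T n : ℝ) : ℂ) := by
    intro n
    rw [hT]
    rcases eq_or_ne n 0 with rfl | hn
    · simp [Real.zero_rpow (by linarith : -s ≠ 0)]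
    · rw [LSeries.term_of_ne_zero hn]
      push_cast
      rw [Complex.ofReal_cpow (by positivity), div_eq_mul_inv, ← Complex.cpow_neg]
      push_cast; rfl
  have hTs : Summable T := by
    have := h1
    unfold LSeriesSummable at this
    rw [funext h2] at this
    exact Complex.summable_ofReal.mp this
  let e := Equiv.sigmaFiberEquiv (fun I : Ideal (𝓞 K) => Ideal.absNorm I)
  have hfin : ∀ n, Finite {I : Ideal (𝓞 K) // Ideal.absNorm I = n} := fun n =>
    (Ideal.finite_setOfPred_absNorm_eq n).to_subtype
  have hval : ∀ n (y : {I : Ideal (𝓞 K) // Ideal.absNorm I = n}), nf K s (e ⟨n, y⟩) = (n:ℝ)^(-s) := by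
    intro n y
    simp only [e, Equiv.sigmaFiberEquiv_apply, nf, y.2]
  have hfib : ∀ n, ∑' y : {I : Ideal (𝓞 K) // Ideal.absNorm I = n}, nf K s (e ⟨n, y⟩) = T n := by
    intro n
    simp only [hval, hT]
    rw [tsum_const, nsmul_eq_mul]
  have hsum : Summable (nf K s ∘ e) := by
    rw [summable_sigma_of_nonneg (by intro x; simp only [Function.comp, nf]; positivity)]
    refine ⟨fun n => ?_, ?_⟩
    · have := Fintype.ofFinite {I : Ideal (𝓞 K) // Ideal.absNorm I = n}
      exact Summable.of_finite
    · simpa only [Function.comp, hfib] using hTs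
  refine ⟨(Equiv.summable_iff e).mp hsum, ?_⟩
  have h5 : ∑' I, nf K s I = ∑' n, T n := by
    rw [← Equiv.tsum_eq e]
    exact (Summable.tsum_sigma hsum).trans (tsum_congr hfib)
  rw [h5, dedekindZeta, LSeries, Complex.ofReal_tsum]
  refine tsum_congr fun n => ?_
  rw [← h2]
  simp

variable {K}

lemma nf_mul (s : ℝ) (I J : Ideal (𝓞 K)) : nf K s (I * J) = nf K s I * nf K s J := by
  unfold nf
  rw [map_mul]; push_cast
  rw [Real.mul_rpow (by positivity) (by positivity)]

/-- Ideals not divisible by any prime in `S`. -/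
def sieve (S : Finset (Ideal (𝓞 K))) : Set (Ideal (𝓞 K)) := {I | ∀ P ∈ S, ¬ P ∣ I}

lemma sieve_step (s : ℝ) (hs : 1 < s) [DecidableEq (Ideal (𝓞 K))] (S : Finset (Ideal (𝓞 K))) (P : Ideal (𝓞 K)) (hPS : P ∉ S)
    (hS : ∀ Q ∈ insert P S, Prime Q) :
    ∑' I, (sieve (insert P S)).indicator (nf K s) I = (1 - nf K s P) * ∑' I, (sieve S).indicator (nf K s) I := by
  have hsm := (nf_summable_and K s hs).1
  have hP : Prime P := hS P (Finset.mem_insert_self _ _)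
  have hsplit : ∀ I, (sieve S).indicator (nf K s) I = (sieve (insert P S)).indicator (nf K s) I +
      (sieve S ∩ {I | P ∣ I}).indicator (nf K s) I := by
    intro I
    by_cases h1 : I ∈ sieve S
    · by_cases h2 : P ∣ I
      · have : I ∉ sieve (insert P S) := fun h => h P (Finset.mem_insert_self _ _) h2
        rw [Set.indicator_of_mem h1, Set.indicator_of_notMem this, Set.indicator_of_mem (show I ∈ sieve S ∩ {I | P ∣ I} from ⟨h1, h2⟩), zero_add]
      · have : I ∈ sieve (insert P S) := by
          intro Q hQ
          rcases Finset.mem_insert.mp hQ with rfl | hQ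
          · exact h2
          · exact h1 Q hQ
        rw [Set.indicator_of_mem h1, Set.indicator_of_mem this, Set.indicator_of_notMem (fun h => h2 h.2), add_zero]
    · have : I ∉ sieve (insert P S) := fun h => h1 fun Q hQ => h Q (Finset.mem_insert_of_mem hQ)
      rw [Set.indicator_of_notMem h1, Set.indicator_of_notMem this, Set.indicator_of_notMem (fun h => h1 h.1), add_zero]
  have hmul : ∑' I, (sieve S ∩ {I | P ∣ I}).indicator (nf K s) I = nf K s P * ∑' I, (sieve S).indicator (nf K s) I := by
    have hinj : Function.Injective (fun J : Ideal (𝓞 K) => P * J) := fun a b h => mul_left_cancel₀ hP.ne_zero h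
    rw [← hinj.tsum_eq, ← tsum_mul_left]
    · refine tsum_congr fun J => ?_
      have hiff : P * J ∈ (sieve S ∩ {I | P ∣ I}) ↔ J ∈ sieve S := by
        constructor
        · rintro ⟨h, -⟩ Q hQ hd
          exact h Q hQ (hd.mul_left _)
        · intro h
          refine ⟨fun Q hQ hd => ?_, Dvd.intro _ rfl⟩
          have hQp := hS Q (Finset.mem_insert_of_mem hQ)
          rcases hQp.dvd_or_dvd hd with hd | hd
          · have : Q = P := associated_iff_eq.mp (hQp.associated_of_dvd hP hd)
            exact hPS (this ▸ hQ)
          · exact h Q hQ hd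
      by_cases hJ : J ∈ sieve S
      · rw [Set.indicator_of_mem (hiff.mpr hJ), Set.indicator_of_mem hJ, nf_mul]
      · rw [Set.indicator_of_notMem (fun h => hJ (hiff.mp h)), Set.indicator_of_notMem hJ, mul_zero]
    · intro I hI
      have : I ∈ sieve S ∩ {I | P ∣ I} := by
        by_contra h
        exact hI (Set.indicator_of_notMem h _)
      obtain ⟨J, rfl⟩ := this.2
      exact ⟨J, rfl⟩
  have hfinal := tsum_congr (L := SummationFilter.unconditional _) hsplit
  rw [Summable.tsum_add (hsm.indicator _) (hsm.indicator _), hmul] at hfinal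
  linarith

lemma sieve_eq (s : ℝ) (hs : 1 < s) (S : Finset (Ideal (𝓞 K))) (hS : ∀ Q ∈ S, Prime Q) :
    ∑' I, (sieve S).indicator (nf K s) I = (∏ P ∈ S, (1 - nf K s P)) * ∑' I, nf K s I := by
  classical
  induction S using Finset.induction_on with
  | empty =>
    have : sieve (∅ : Finset (Ideal (𝓞 K))) = Set.univ := by
      ext I; simp [sieve]
    simp [this]
  | insert P S hPS ih =>
    rw [sieve_step s hs S P hPS hS, ih (fun Q hQ => hS Q (Finset.mem_insert_of_mem hQ)), Finset.prod_insert hPS]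
    ring

lemma euler_tendsto (s : ℝ) (hs : 1 < s) (S : ℕ → Finset (Ideal (𝓞 K))) (hS : ∀ n, ∀ Q ∈ S n, Prime Q)
    (hS2 : ∀ P : Ideal (𝓞 K), Prime P → ∀ n, Ideal.absNorm P < n → P ∈ S n) :
    Tendsto (fun n => (∏ P ∈ S n, (1 - nf K s P)) * ∑' I, nf K s I) atTop (𝓝 1) := by
  classical
  have hsm := (nf_summable_and K s hs).1
  have h1 : ∑' I : Ideal (𝓞 K), (if I = ⊤ then (1:ℝ) else 0) = 1 := by
    rw [tsum_ite_eq]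
  have hrw : (fun n => (∏ P ∈ S n, (1 - nf K s P)) * ∑' I, nf K s I) =
      fun n => ∑' I, (sieve (S n)).indicator (nf K s) I := funext fun n => (sieve_eq s hs _ (hS n)).symm
  rw [hrw, ← h1]
  refine tendsto_tsum_of_dominated_convergence hsm (fun I => ?_) (Eventually.of_forall fun n I => ?_)
  · apply tendsto_const_nhds.congr'
    by_cases hI : I = ⊤
    · refine Eventually.of_forall fun n => ?_
      beta_reduce
      rw [if_pos hI, Set.indicator_of_mem]
      · simp [nf, hI]
      · intro P hP hd
        rw [hI] at hd
        exact (hS n P hP).not_isUnit (isUnit_of_dvd_one (by simpa using hd))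
    · rw [if_neg hI]
      by_cases hb : I = ⊥
      · refine Eventually.of_forall fun n => ?_
        have : nf K s I = 0 := by simp [nf, hb, Real.zero_rpow (by linarith : -s ≠ 0)]
        simp [Set.indicator_apply, this]
      · filter_upwards [eventually_gt_atTop (Ideal.absNorm I)] with n hn
        rw [Set.indicator_of_notMem]
        intro hmem
        obtain ⟨P, hP, hd⟩ := WfDvdMonoid.exists_irreducible_factor (a := I)
          (by rwa [Ideal.isUnit_iff]) hb
        refine hmem P (hS2 P hP.prime n (lt_of_le_of_lt (Nat.le_of_dvd ?_ ?_) hn)) hd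
        · exact Nat.pos_of_ne_zero (by rwa [Ne, Ideal.absNorm_eq_zero_iff])
        · exact map_dvd Ideal.absNorm hd
  · have : 0 ≤ nf K s I := by unfold nf; positivity
    rw [Real.norm_of_nonneg (Set.indicator_nonneg (fun I _ => by unfold nf; positivity) _)]
    exact Set.indicator_le_self' (fun _ _ => by unfold nf; positivity) I

end
end Stmt16


namespace Stmt16
open Filter Topology

lemma card_char_eq (p : ℕ) [Fact p.Prime] (a : (ZMod p)ˣ) (g : ℕ) (hg : g * orderOf a = p - 1) (w : ℂ)
    (hw : w ^ orderOf a = 1) :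
    Finset.card {χ : DirichletCharacter ℂ p | χ a = w} = g := by
  have hf : 0 < orderOf a := orderOf_pos a
  have hw0 : w ≠ 0 := by rintro rfl; simp [hf.ne'] at hw
  have h1 : ∀ χ : DirichletCharacter ℂ p, ∑ k ∈ Finset.range (orderOf a), (χ a * w⁻¹) ^ k =
      if χ a = w then (orderOf a : ℂ) else 0 := by
    intro χ
    split_ifs with h
    · rw [h, mul_inv_cancel₀ hw0]; simp
    · have hne : χ a * w⁻¹ ≠ 1 := by
        intro h'
        exact h (by field_simp at h'; exact h')
      rw [geom_sum_eq hne, mul_pow, ← map_pow, inv_pow, hw, ← Units.val_pow_eq_pow_val, pow_orderOf_eq_one]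
      simp
  have h2 : ∑ χ : DirichletCharacter ℂ p, ∑ k ∈ Finset.range (orderOf a), (χ a * w⁻¹) ^ k = ((p - 1 : ℕ) : ℂ) := by
    rw [Finset.sum_comm, ← Finset.sum_erase_add _ _ (Finset.mem_range.mpr hf)]
    have h3 : ∀ k ∈ (Finset.range (orderOf a)).erase 0, ∑ χ : DirichletCharacter ℂ p, (χ a * w⁻¹) ^ k = 0 := by
      intro k hk
      obtain ⟨hk0, hk⟩ := Finset.mem_erase.mp hk
      simp only [mul_pow, ← map_pow, ← Finset.sum_mul]
      have := DirichletCharacter.sum_char_inv_mul_char_eq ℂ (n := p) isUnit_one ((a:ZMod p)^k)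
      simp only [inv_one, map_one, one_mul] at this
      rw [this, if_neg, zero_mul]
      intro h
      have : a ^ k = 1 := Units.ext (by simpa using h.symm)
      exact pow_ne_one_of_lt_orderOf hk0 (Finset.mem_range.mp hk) this
    rw [Finset.sum_eq_zero h3, zero_add]
    simp only [pow_zero]
    rw [Finset.sum_const, nsmul_eq_mul, mul_one, Finset.card_univ, ← Nat.card_eq_fintype_card,
      DirichletCharacter.card_eq_totient_of_hasEnoughRootsOfUnity, Nat.totient_prime Fact.out]
  simp only [h1] at h2
  rw [Finset.sum_ite, Finset.sum_const_zero, add_zero, Finset.sum_const, nsmul_eq_mul, ← hg] at h2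
  have h4 : Finset.card {χ : DirichletCharacter ℂ p | χ a = w} * orderOf a = g * orderOf a := by exact_mod_cast h2
  exact Nat.eq_of_mul_eq_mul_right hf h4

lemma prod_char (p : ℕ) [Fact p.Prime] (a : (ZMod p)ˣ) (g : ℕ) (hg : g * orderOf a = p - 1) (x : ℂ) :
    ∏ χ : DirichletCharacter ℂ p, (1 - χ a * x) = (1 - x ^ orderOf a) ^ g := by
  classical
  have hf : 0 < orderOf a := orderOf_pos a
  have hmap : ∀ χ ∈ (Finset.univ : Finset (DirichletCharacter ℂ p)), χ a ∈ Polynomial.nthRootsFinset (orderOf a) (1:ℂ) := by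
    intro χ _
    rw [Polynomial.mem_nthRootsFinset hf, ← map_pow, ← Units.val_pow_eq_pow_val, pow_orderOf_eq_one]
    simp
  rw [← Finset.prod_fiberwise_of_maps_to hmap]
  have hr : IsPrimitiveRoot (Complex.exp (2 * Real.pi * Complex.I / (orderOf a : ℕ))) (orderOf a) :=
    Complex.isPrimitiveRoot_exp _ hf.ne'
  have := hr.pow_sub_pow_eq_prod_sub_mul 1 x hf
  rw [one_pow] at this
  rw [this, ← Finset.prod_pow]
  refine Finset.prod_congr rfl fun w hw => ?_
  rw [Polynomial.mem_nthRootsFinset hf] at hw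
  rw [← card_char_eq p a g hg w hw]
  rw [Finset.prod_congr rfl (g := fun _ => 1 - w * x)]
  · simp
  · intro χ hχ
    rw [(Finset.mem_filter.mp hχ).2]

section
variable (K : Type) [Field K] [NumberField K]

/-- The finset of primes above `q`. -/
noncomputable abbrev pov (q : ℕ) : Finset (Ideal (𝓞 K)) :=
  IsDedekindDomain.primesOverFinset (Ideal.span {(q:ℤ)}) (𝓞 K)

lemma mem_pov (q : ℕ) (hq : q.Prime) (P : Ideal (𝓞 K)) :
    P ∈ pov K q ↔ P.IsPrime ∧ P.LiesOver (Ideal.span {(q:ℤ)}) := by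
  have := Fact.mk hq
  have : (Ideal.span {(q:ℤ)}).IsMaximal := Int.ideal_span_isMaximal_of_prime q
  rw [IsDedekindDomain.mem_primesOverFinset_iff (by simpa using hq.ne_zero)]
  rfl

lemma loc_ne (p : ℕ) [Fact p.Prime] [IsCyclotomicExtension {p} ℚ K] (s : ℝ) (q : ℕ) (hq : q.Prime) (hqp : q ≠ p) :
    ((∏ P ∈ pov K q, (1 - nf K s P) : ℝ) : ℂ) = ∏ χ : DirichletCharacter ℂ p, (1 - χ q * (q:ℂ) ^ (-(s:ℂ))) := by
  have hp : p.Prime := Fact.out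
  have := Fact.mk hq
  have : (Ideal.span {(q:ℤ)}).IsMaximal := Int.ideal_span_isMaximal_of_prime q
  have hnd : ¬ q ∣ p := fun h => hqp ((Nat.prime_dvd_prime_iff_eq hq hp).mp h)
  have hcop : q.Coprime p := (Nat.coprime_primes hq hp).mpr hqp
  let a : (ZMod p)ˣ := ZMod.unitOfCoprime q hcop
  have ha : (a : ZMod p) = q := ZMod.coe_unitOfCoprime q hcop
  have hao : orderOf (q : ZMod p) = orderOf a := by rw [← ha, orderOf_units]
  have : IsGalois ℚ K := IsCyclotomicExtension.isGalois {p} ℚ K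
  have hcard := Ideal.ncard_primesOver_mul_ramificationIdxIn_mul_inertiaDegIn (Ideal.span {(q:ℤ)}) (𝓞 K) Gal(K/ℚ)
  rw [IsCyclotomicExtension.Rat.inertiaDegIn_eq_of_not_dvd (m := p) q K hnd,
    IsCyclotomicExtension.Rat.ramificationIdxIn_eq_of_not_dvd (m := p) q K hnd, one_mul, hao,
    IsGalois.card_aut_eq_finrank, IsCyclotomicExtension.finrank K (Polynomial.cyclotomic.irreducible_rat hp.pos),
    Nat.totient_prime hp, ← IsDedekindDomain.coe_primesOverFinset (by simpa using hq.ne_zero) (𝓞 K), Set.ncard_coe_finset] at hcard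
  have h1 : ∀ P ∈ pov K q, (1 - nf K s P) = 1 - ((q:ℝ) ^ (-s)) ^ orderOf a := by
    intro P hP
    obtain ⟨h1, h2⟩ := (mem_pov K q hq P).mp hP
    rw [nf, ← Ideal.pow_inertiaDeg q, IsCyclotomicExtension.Rat.inertiaDeg_eq_of_not_dvd (m := p) q K P hnd, hao]
    push_cast
    rw [← Real.rpow_natCast_mul (by positivity), ← Real.rpow_mul_natCast (by positivity), mul_comm]
  rw [Finset.prod_congr rfl h1, Finset.prod_const, ← ha, prod_char p a _ hcard]
  push_cast
  rw [Complex.ofReal_cpow (by positivity)]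
  push_cast
  rfl

lemma loc_p (p : ℕ) [Fact p.Prime] [IsCyclotomicExtension {p} ℚ K] (s : ℝ) :
    ∏ P ∈ pov K p, (1 - nf K s P) = 1 - (p:ℝ) ^ (-s) := by
  have hp : p.Prime := Fact.out
  have : (Ideal.span {(p:ℤ)}).IsMaximal := Int.ideal_span_isMaximal_of_prime p
  have hcard := IsCyclotomicExtension.Rat.ncard_primesOver_of_prime p K
  rw [← IsDedekindDomain.coe_primesOverFinset (by simpa using hp.ne_zero) (𝓞 K), Set.ncard_coe_finset] at hcard
  obtain ⟨P, hP⟩ := Finset.card_eq_one.mp hcard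
  have hPm : P ∈ pov K p := by rw [pov, hP]; simp
  obtain ⟨h1, h2⟩ := (mem_pov K p hp P).mp hPm
  rw [pov, hP, Finset.prod_singleton, nf, ← Ideal.pow_inertiaDeg p, IsCyclotomicExtension.Rat.inertiaDeg_eq_of_prime p K P,
    pow_one]

lemma tendsto_pov (s : ℝ) (hs : 1 < s) :
    Tendsto (fun n : ℕ => (∏ q ∈ n.primesBelow, ∏ P ∈ pov K q, (1 - nf K s P)) * ∑' I, nf K s I) atTop (𝓝 1) := by
  classical
  have hdis : ∀ n : ℕ, (n.primesBelow : Set ℕ).PairwiseDisjoint (fun q => pov K q) := by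
    intro n q hq q' hq' hne
    rw [Function.onFun, Finset.disjoint_left]
    intro P hP hP'
    have hqp : q.Prime := Nat.prime_of_mem_primesBelow hq
    have hqp' : q'.Prime := Nat.prime_of_mem_primesBelow hq'
    obtain ⟨h1, h2⟩ := (mem_pov K q hqp P).mp hP
    obtain ⟨h1', h2'⟩ := (mem_pov K q' hqp' P).mp hP'
    have e : Ideal.span {(q:ℤ)} = Ideal.span {(q':ℤ)} := h2.over.trans h2'.over.symm
    rw [Ideal.span_singleton_eq_span_singleton, Int.associated_iff_natAbs] at e
    exact hne (by simpa using e)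
  have := euler_tendsto (K := K) s hs (fun n => n.primesBelow.biUnion fun q => pov K q) ?_ ?_
  · refine this.congr fun n => ?_
    rw [Finset.prod_biUnion (hdis n)]
  · intro n Q hQ
    obtain ⟨q, hq, hQ⟩ := Finset.mem_biUnion.mp hQ
    have hqp : q.Prime := Nat.prime_of_mem_primesBelow hq
    obtain ⟨h1, h2⟩ := (mem_pov K q hqp Q).mp hQ
    refine Ideal.prime_of_isPrime ?_ h1
    rintro rfl
    have := h2.over
    rw [Ideal.under_bot] at this
    simp at this
    exact hqp.ne_zero this
  · intro P hP n hn
    have hPp : P.IsPrime := Ideal.isPrime_of_prime hP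
    have hu : (P.under ℤ) ≠ ⊥ := by
      intro h
      exact hP.ne_zero (Ideal.eq_bot_of_comap_eq_bot h)
    obtain ⟨z, hz⟩ := (IsPrincipalIdealRing.principal (P.under ℤ)).principal
    have hz' : P.under ℤ = Ideal.span {z} := hz
    have hzp : Prime z := by
      rw [← Ideal.span_singleton_prime, ← hz']
      · infer_instance
      · rintro rfl; exact hu (by simp [hz'])
    have hq : z.natAbs.Prime := Int.prime_iff_natAbs_prime.mp hzp
    have hover : P.LiesOver (Ideal.span {((z.natAbs:ℕ):ℤ)}) := by
      constructor
      rw [hz', Int.span_natAbs]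
    refine Finset.mem_biUnion.mpr ⟨z.natAbs, ?_, (mem_pov K _ hq P).mpr ⟨hPp, hover⟩⟩
    refine Nat.mem_primesBelow.mpr ⟨lt_of_le_of_lt ?_ hn, hq⟩
    rw [← Ideal.pow_inertiaDeg z.natAbs P]
    refine Nat.le_self_pow ?_ _
    intro h0
    have h3 := Ideal.pow_inertiaDeg z.natAbs P
    rw [h0, pow_zero] at h3
    exact hPp.ne_top (Ideal.absNorm_eq_one_iff.mp h3.symm)

end
end Stmt16


namespace Stmt16
open Filter Topology

section
variable (K : Type) [Field K] [NumberField K]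

lemma zeta_factor (p : ℕ) [Fact p.Prime] [IsCyclotomicExtension {p} ℚ K] (s : ℝ) (hs : 1 < s) :
    dedekindZeta K s * (1 - (p:ℂ) ^ (-(s:ℂ))) = ∏ χ : DirichletCharacter ℂ p, DirichletCharacter.LFunction χ s := by
  have hp : p.Prime := Fact.out
  have hs' : 1 < (s:ℂ).re := by simpa using hs
  have hA : Tendsto (fun n : ℕ => ((∏ q ∈ n.primesBelow, ((∏ P ∈ pov K q, (1 - nf K s P) : ℝ) : ℂ))) * dedekindZeta K s)
      atTop (𝓝 1) := by
    have := (Complex.continuous_ofReal.tendsto 1).comp (tendsto_pov K s hs)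
    rw [Complex.ofReal_one] at this
    refine this.congr fun n => ?_
    rw [(nf_summable_and K s hs).2]
    simp only [Function.comp]
    push_cast
    rfl
  have hB : Tendsto (fun n : ℕ => ∏ χ : DirichletCharacter ℂ p, ∏ q ∈ n.primesBelow, (1 - χ q * (q:ℂ) ^ (-(s:ℂ)))⁻¹)
      atTop (𝓝 (∏ χ : DirichletCharacter ℂ p, DirichletCharacter.LFunction χ s)) := by
    refine tendsto_finsetProd _ fun χ _ => ?_
    rw [DirichletCharacter.LFunction_eq_LSeries χ hs']
    exact DirichletCharacter.LSeries_eulerProduct χ hs'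
  have hAB := hA.mul hB
  rw [one_mul] at hAB
  refine tendsto_nhds_unique ?_ hAB
  apply tendsto_const_nhds.congr'
  filter_upwards [eventually_gt_atTop p] with n hn
  rw [Finset.prod_comm]
  have hnz : ∀ q : ℕ, q.Prime → ∀ χ : DirichletCharacter ℂ p, 1 - χ q * (q:ℂ) ^ (-(s:ℂ)) ≠ 0 := by
    intro q hq χ h
    have h1 : ‖χ q * (q:ℂ) ^ (-(s:ℂ))‖ = 1 := by
      rw [← sub_eq_zero.mp h]; simp
    rw [norm_mul, Complex.norm_natCast_cpow_of_pos hq.pos] at h1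
    have h2 : ‖χ (q : ZMod p)‖ ≤ 1 := DirichletCharacter.norm_le_one χ _
    have h3 : (q:ℝ) ^ (-(s:ℂ)).re < 1 := by
      apply Real.rpow_lt_one_of_one_lt_of_neg
      · exact_mod_cast hq.one_lt
      · simp; linarith
    have h4 : 0 < (q:ℝ) ^ (-(s:ℂ)).re := Real.rpow_pos_of_pos (by exact_mod_cast hq.pos) _
    nlinarith [norm_nonneg (χ (q : ZMod p))]
  have key : (∏ q ∈ n.primesBelow, ((∏ P ∈ pov K q, (1 - nf K s P) : ℝ) : ℂ)) *
      ∏ q ∈ n.primesBelow, ∏ χ : DirichletCharacter ℂ p, (1 - χ q * (q:ℂ) ^ (-(s:ℂ)))⁻¹ = 1 - (p:ℂ) ^ (-(s:ℂ)) := by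
    rw [← Finset.prod_mul_distrib, Finset.prod_eq_single p]
    · rw [loc_p K p s]
      have h0 : ∀ χ : DirichletCharacter ℂ p, χ ((p:ℕ):ZMod p) = 0 := by
        intro χ; rw [ZMod.natCast_self]; exact MulChar.map_zero χ
      simp only [h0]
      push_cast
      rw [Complex.ofReal_cpow (by positivity)]
      simp
    · intro q hq hqp
      have hqpr : q.Prime := Nat.prime_of_mem_primesBelow hq
      rw [loc_ne K p s q hqpr hqp, ← Finset.prod_mul_distrib]
      exact Finset.prod_eq_one fun χ _ => mul_inv_cancel₀ (hnz q hqpr χ)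
    · intro h
      exact absurd (Nat.mem_primesBelow.mpr ⟨hn, hp⟩) h
  rw [← key]
  ring

lemma residue_eq (p : ℕ) [Fact p.Prime] [IsCyclotomicExtension {p} ℚ K] :
    dedekindZeta_residue K = ∏ χ ∈ (Finset.univ : Finset (DirichletCharacter ℂ p)).erase 1,
      ‖DirichletCharacter.LFunction χ 1‖ := by
  have hp : p.Prime := Fact.out
  have h1 : Tendsto (fun s : ℝ => ((s:ℂ) - 1) * dedekindZeta K s * (1 - (p:ℂ) ^ (-(s:ℂ)))) (𝓝[>] 1)
      (𝓝 ((dedekindZeta_residue K : ℂ) * (1 - (p:ℂ)⁻¹))) := by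
    refine Tendsto.mul ?_ ?_
    · exact tendsto_sub_one_mul_dedekindZeta_nhdsGT K
    · refine tendsto_nhdsWithin_of_tendsto_nhds ?_
      have hc : Continuous (fun s : ℝ => 1 - (p:ℂ) ^ (-(s:ℂ))) := by
        refine continuous_const.sub (Continuous.const_cpow (by fun_prop) (Or.inl ?_))
        exact_mod_cast hp.ne_zero
      have := hc.tendsto 1
      simpa [Complex.cpow_neg_one] using this
  have h2 : Tendsto (fun s : ℝ => ((s:ℂ) - 1) * DirichletCharacter.LFunctionTrivChar p s *
      ∏ χ ∈ (Finset.univ : Finset (DirichletCharacter ℂ p)).erase 1, DirichletCharacter.LFunction χ s) (𝓝[>] 1)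
      (𝓝 ((1 - (p:ℂ)⁻¹) * ∏ χ ∈ (Finset.univ : Finset (DirichletCharacter ℂ p)).erase 1,
        DirichletCharacter.LFunction χ 1)) := by
    refine Tendsto.mul ?_ ?_
    · have := DirichletCharacter.LFunctionTrivChar_residue_one (N := p)
      rw [hp.primeFactors, Finset.prod_singleton] at this
      refine this.comp (tendsto_nhdsWithin_iff.mpr ⟨?_, ?_⟩)
      · refine tendsto_nhdsWithin_of_tendsto_nhds ?_
        simpa using Complex.continuous_ofReal.tendsto 1
      · filter_upwards [self_mem_nhdsWithin] with s hs
        have : (1:ℝ) < s := hs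
        simp only [Set.mem_compl_iff, Set.mem_singleton_iff]
        exact_mod_cast this.ne'
    · refine tendsto_finsetProd _ fun χ hχ => ?_
      refine tendsto_nhdsWithin_of_tendsto_nhds ?_
      have hd := (DirichletCharacter.differentiable_LFunction (Finset.ne_of_mem_erase hχ)).continuous
      have := (hd.comp Complex.continuous_ofReal).tendsto 1
      simpa [Function.comp_def] using this
  have h3 := tendsto_nhds_unique (h1.congr' ?_) h2
  · have hne : (1 - (p:ℂ)⁻¹) ≠ 0 := by
      rw [sub_ne_zero]
      intro h
      have : (p:ℂ) = 1 := by rw [← inv_inv (p:ℂ), ← h, inv_one]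
      exact hp.one_lt.ne' (by exact_mod_cast this)
    rw [mul_comm] at h3
    have h4 := mul_left_cancel₀ hne h3
    have h5 := congrArg norm h4
    rw [Complex.norm_real, Real.norm_of_nonneg (dedekindZeta_residue_pos K).le, norm_prod] at h5
    exact h5
  · filter_upwards [self_mem_nhdsWithin] with s hs
    rw [mul_assoc, zeta_factor K p s hs, mul_assoc, ← Finset.mul_prod_erase _ _ (Finset.mem_univ 1)]

end
end Stmt16


namespace Stmt16

/-- product over even nontrivial characters of `|Σ λ(c) χ(c)|`. -/
noncomputable def evenProd (p : ℕ) [Fact p.Prime] : ℝ :=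
  ∏ χ : {χ : DirichletCharacter ℂ p // χ (-1) = 1},
    if χ.1 = 1 then 1 else ‖∑ c : ZMod p, ((lam p c : ℝ) : ℂ) * χ.1 c‖

lemma inv_neg_one (p : ℕ) [Fact p.Prime] (χ : DirichletCharacter ℂ p) (ε : ℂ) (hε : ε = 1 ∨ ε = -1) :
    χ⁻¹ (-1) = ε ↔ χ (-1) = ε := by
  rw [← star_apply]
  rcases hε with rfl | rfl
  · rw [starRingEnd_apply, star_eq_iff_star_eq]; simp [eq_comm]
  · rw [starRingEnd_apply, star_eq_iff_star_eq]; simp [eq_comm]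

/-- inversion on characters of given parity -/
noncomputable def invEquiv (p : ℕ) [Fact p.Prime] (ε : ℂ) (hε : ε = 1 ∨ ε = -1) :
    {χ : DirichletCharacter ℂ p // χ (-1) = ε} ≃ {χ : DirichletCharacter ℂ p // χ (-1) = ε} :=
  (Equiv.inv (DirichletCharacter ℂ p)).subtypeEquiv fun χ => (inv_neg_one p χ ε hε).symm

lemma prod_L (p r : ℕ) [Fact p.Prime] (hpr : p = 2 * r + 1) (hr : 0 < r) : ∃ m : ℕ,
    (∏ χ ∈ (Finset.univ : Finset (DirichletCharacter ℂ p)).erase 1, ‖DirichletCharacter.LFunction χ 1‖) *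
      (Real.sqrt p) ^ (2 * r - 1) = evenProd p * ((Real.pi / p) ^ r * ((p:ℝ) ^ (r - 1) * m)) := by
  classical
  have hp : p.Prime := Fact.out
  obtain ⟨m, hm⟩ := prod_odd p r hpr hr
  refine ⟨m, ?_⟩
  have hcard : ((Finset.univ : Finset (DirichletCharacter ℂ p)).erase 1).card = 2 * r - 1 := by
    rw [Finset.card_erase_of_mem (Finset.mem_univ _), Finset.card_univ, ← Nat.card_eq_fintype_card,
      DirichletCharacter.card_eq_totient_of_hasEnoughRootsOfUnity, Nat.totient_prime hp]
    omega
  rw [← hcard, ← Finset.prod_const, ← Finset.prod_mul_distrib]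
  let H : DirichletCharacter ℂ p → ℝ := fun χ => if χ = 1 then 1 else ‖DirichletCharacter.LFunction χ 1‖ * Real.sqrt p
  have h1 : ∏ χ ∈ (Finset.univ : Finset (DirichletCharacter ℂ p)).erase 1,
      (‖DirichletCharacter.LFunction χ 1‖ * Real.sqrt p) = ∏ χ, H χ := by
    rw [← Finset.mul_prod_erase _ _ (Finset.mem_univ (1 : DirichletCharacter ℂ p))]
    simp only [H, if_true, one_mul]
    refine Finset.prod_congr rfl fun χ hχ => ?_
    rw [if_neg (Finset.ne_of_mem_erase hχ)]
  rw [h1, ← Fintype.prod_subtype_mul_prod_subtype (fun χ : DirichletCharacter ℂ p => χ (-1) = 1)]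
  congr 1
  · unfold evenProd
    rw [← Equiv.prod_comp (invEquiv p 1 (Or.inl rfl))]
    refine Finset.prod_congr rfl fun χ _ => ?_
    have e : ((invEquiv p 1 (Or.inl rfl)) χ).1 = χ.1⁻¹ := rfl
    rw [e]
    by_cases h : χ.1 = 1
    · simp [H, h]
    · simp only [H, inv_eq_one, if_neg h]
      rw [LFunction_one_even p _ (by simpa using h) ((inv_neg_one p χ.1 1 (Or.inl rfl)).mpr χ.2), inv_inv]
  · let e2 : {χ : DirichletCharacter ℂ p // ¬ χ (-1) = 1} ≃ {χ : DirichletCharacter ℂ p // χ (-1) = -1} :=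
      Equiv.subtypeEquivRight fun χ => by
        constructor
        · intro h
          rcases DirichletCharacter.even_or_odd χ with h' | h'
          · exact absurd h' h
          · exact h'
        · intro h h'
          rw [h] at h'
          norm_num at h'
    have h2 : ∏ χ : {χ : DirichletCharacter ℂ p // ¬ χ (-1) = 1}, H χ.1 =
        ∏ χ : {χ : DirichletCharacter ℂ p // χ (-1) = -1}, H χ.1 :=
      Fintype.prod_equiv e2 _ _ (fun χ => rfl)
    rw [h2, ← hm, ← card_sign p r hpr hr (-1) (Or.inr rfl), ← Finset.card_univ, ← Finset.prod_const,
      ← Finset.prod_mul_distrib, ← Equiv.prod_comp (invEquiv p (-1) (Or.inr rfl))]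
    refine Finset.prod_congr rfl fun χ _ => ?_
    have e : ((invEquiv p (-1) (Or.inr rfl)) χ).1 = χ.1⁻¹ := rfl
    rw [e]
    have hne : χ.1⁻¹ ≠ 1 := by
      intro h
      have h3 := χ.2
      rw [inv_eq_one.mp h] at h3
      have h4 : (1 : DirichletCharacter ℂ p) (-1) = 1 := MulChar.one_apply (isUnit_one.neg)
      rw [h4] at h3
      norm_num at h3
    simp only [H, if_neg hne]
    rw [LFunction_one_odd p _ hne ((inv_neg_one p χ.1 (-1) (Or.inr rfl)).mpr χ.2), inv_inv]

lemma class_formula (K : Type) [Field K] [NumberField K] (p r : ℕ) [Fact p.Prime] [IsCyclotomicExtension {p} ℚ K]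
    (hpr : p = 2 * r + 1) (hr : 0 < r) : ∃ m : ℕ,
    (2:ℝ) ^ (r - 1) * Units.regulator K * classNumber K = m * evenProd p := by
  have hp : p.Prime := Fact.out
  obtain ⟨m, hm⟩ := prod_L p r hpr hr
  refine ⟨m, ?_⟩
  have hodd : ¬ Even p := by rw [hpr]; simp
  have h1 := residue_eq K p
  rw [dedekindZeta_residue_def, IsCyclotomicExtension.Rat.nrRealPlaces_eq_zero (n := p) K (by omega),
    IsCyclotomicExtension.Rat.nrComplexPlaces_eq_totient_div_two p K, IsCyclotomicExtension.Rat.torsionOrder_eq (n := p),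
    if_neg hodd, IsCyclotomicExtension.Rat.discr_prime p K, Nat.totient_prime hp,
    show (p - 1) / 2 = r by omega, show p - 2 = 2 * r - 1 by omega] at h1
  rw [← h1] at hm
  have hp0 : (0:ℝ) < p := by exact_mod_cast hp.pos
  have habs : |(((-1:ℤ) ^ r * (p:ℤ) ^ (2 * r - 1) : ℤ) : ℝ)| = (p:ℝ) ^ (2 * r - 1) := by
    push_cast
    rw [abs_mul, abs_pow, abs_neg, abs_one, one_pow, one_mul, abs_of_nonneg (by positivity)]
  have hsq : Real.sqrt |(((-1:ℤ) ^ r * (p:ℤ) ^ (2 * r - 1) : ℤ) : ℝ)| = (Real.sqrt p) ^ (2 * r - 1) := by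
    rw [habs, Real.sqrt_eq_iff_eq_sq (by positivity) (by positivity), ← pow_mul, mul_comm (2 * r - 1) 2, pow_mul,
      Real.sq_sqrt hp0.le]
  rw [hsq] at hm
  have hs0 : (Real.sqrt p) ^ (2 * r - 1) ≠ 0 := by positivity
  obtain ⟨k, rfl⟩ : ∃ k, r = k + 1 := ⟨r - 1, by omega⟩
  simp only [Nat.add_sub_cancel, pow_zero, one_mul] at hm ⊢
  push_cast at hm
  have hpi := Real.pi_pos
  field_simp at hm
  rw [mul_pow, pow_succ, pow_succ, pow_succ] at hm
  have hne : (Real.pi ^ k * Real.pi) ≠ 0 := by positivity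
  apply mul_left_cancel₀ hne
  have hdiv : (Real.pi / (p:ℝ)) ^ k * (Real.pi / p) * p ^ k * p = Real.pi ^ k * Real.pi := by
    rw [div_pow]; field_simp
  linear_combination hm / 2 + evenProd p * m * hdiv

end Stmt16


namespace Stmt16

lemma lam_zero (p : ℕ) [NeZero p] : lam p 0 = 0 := by simp [lam]

lemma sum_lam (p : ℕ) [Fact p.Prime] : ∑ c : ZMod p, lam p c = Real.log p := by
  have hp : p.Prime := Fact.out
  have h1 : ∑ c : ZMod p, lam p c = ∑ k ∈ Finset.range p, lam p (k : ZMod p) := by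
    refine Finset.sum_nbij' (fun c => c.val) (fun k => (k : ZMod p)) ?_ ?_ ?_ ?_ ?_
    · intro c _; exact Finset.mem_range.mpr (ZMod.val_lt c)
    · intro k _; exact Finset.mem_univ _
    · intro c _; simp
    · intro k hk; exact ZMod.val_cast_of_lt (Finset.mem_range.mp hk)
    · intro c _; simp
  obtain ⟨n, rfl⟩ : ∃ n, p = n + 1 := ⟨p - 1, by have := hp.pos; omega⟩
  rw [h1, Finset.sum_range_succ']
  simp only [Nat.cast_zero, lam_zero, add_zero]
  have hprim : IsPrimitiveRoot (ZMod.stdAddChar (1 : ZMod (n+1)) : ℂ) (n + 1) := by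
    have h := Complex.isPrimitiveRoot_exp (n + 1) (by omega)
    convert h using 1
    have := ZMod.stdAddChar_coe (N := n + 1) 1
    simpa using this
  have h2 := hprim.prod_one_sub_pow_eq_order
  have h3 := congrArg (fun z : ℂ => Real.log ‖z‖) h2
  simp only [norm_prod] at h3
  rw [Real.log_prod] at h3
  · convert h3 using 1
    · refine Finset.sum_congr rfl fun k _ => ?_
      rw [lam, ← AddChar.map_nsmul_eq_pow]
      simp
    · rw [← Nat.cast_succ, Complex.norm_natCast]
  · intro k hk
    rw [norm_ne_zero_iff, sub_ne_zero]
    exact (hprim.pow_ne_one_of_pos_of_lt (by omega) (by have := Finset.mem_range.mp hk; omega)).symm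

lemma sum_lam_half (p r : ℕ) [Fact p.Prime] (hpr : p = 2 * r + 1) (i : Fin r) :
    ∑ j : Fin r, 2 * lam p ((((i:ℕ)+1:ℕ) : ZMod p) * (((j:ℕ)+1:ℕ) : ZMod p)) = Real.log p := by
  have hi : (((i:ℕ)+1:ℕ) : ZMod p) ≠ 0 := by
    rw [Ne, ZMod.natCast_eq_zero_iff]
    intro h
    have := Nat.le_of_dvd (by omega) h
    have := i.2
    omega
  rw [← sum_lam p, ← Equiv.sum_comp (Equiv.mulLeft₀ _ hi), sum_half p r hpr]
  simp only [Equiv.mulLeft₀_apply, mul_zero, lam_zero, zero_add, mul_neg, lam_neg]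
  exact Finset.sum_congr rfl fun j _ => by ring

/-- logarithm matrix -/
noncomputable def Amat (p r : ℕ) [Fact p.Prime] : Matrix (Fin r) (Fin r) ℝ :=
  Matrix.of fun i j => 2 * lam p ((((i:ℕ)+1:ℕ) : ZMod p) * (((j:ℕ)+1:ℕ) : ZMod p))

/-- regulator matrix -/
noncomputable def Nmat (p r : ℕ) [Fact p.Prime] : Matrix (Fin r) (Fin r) ℝ :=
  Matrix.of fun i j => if (i:ℕ) = 0 then 2 else
    2 * (lam p ((((i:ℕ)+1:ℕ) : ZMod p) * (((j:ℕ)+1:ℕ) : ZMod p)) - lam p (((j:ℕ)+1:ℕ) : ZMod p))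

lemma det_A (p r : ℕ) [Fact p.Prime] (hpr : p = 2 * r + 1) (hr : 0 < r) :
    |(Amat p r).det| = Real.log p * evenProd p := by
  classical
  have hp : p.Prime := Fact.out
  have h := det_half p r hpr hr 1 (Or.inl rfl) (fun c => ((lam p c : ℝ) : ℂ))
  have h1 : (Matrix.of fun i j : Fin r => ((lam p ((((i:ℕ)+1:ℕ) : ZMod p) * (((j:ℕ)+1:ℕ) : ZMod p)) : ℝ) : ℂ) +
      1 * ((lam p (-((((i:ℕ)+1:ℕ) : ZMod p) * (((j:ℕ)+1:ℕ) : ZMod p))) : ℝ) : ℂ)) = Complex.ofRealHom.mapMatrix (Amat p r) := by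
    ext i j
    simp only [Amat, Matrix.of_apply, lam_neg, RingHom.mapMatrix_apply, Matrix.map_apply, Complex.ofRealHom_eq_coe]
    push_cast; ring
  rw [h1, ← RingHom.map_det, Complex.ofRealHom_eq_coe, Complex.norm_real, Real.norm_eq_abs] at h
  rw [h]
  have hone : (1 : DirichletCharacter ℂ p) (-1) = 1 := MulChar.one_apply (isUnit_one.neg)
  unfold evenProd
  rw [← Finset.mul_prod_erase Finset.univ _ (Finset.mem_univ (⟨1, hone⟩ : {χ : DirichletCharacter ℂ p // χ (-1) = 1})),
    ← Finset.mul_prod_erase Finset.univ (fun χ : {χ : DirichletCharacter ℂ p // χ (-1) = 1} => if χ.1 = 1 then (1:ℝ) else _)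
      (Finset.mem_univ (⟨1, hone⟩ : {χ : DirichletCharacter ℂ p // χ (-1) = 1}))]
  simp only [if_true, one_mul]
  congr 1
  · have : ∑ c : ZMod p, ((lam p c : ℝ) : ℂ) * (1 : DirichletCharacter ℂ p) c = ((Real.log p : ℝ) : ℂ) := by
      rw [← sum_lam]
      push_cast
      refine Finset.sum_congr rfl fun c _ => ?_
      by_cases hc : c = 0
      · simp [hc, lam_zero]
      · rw [MulChar.one_apply (isUnit_iff_ne_zero.mpr hc), mul_one]
    rw [this, Complex.norm_real, Real.norm_of_nonneg (Real.log_natCast_nonneg p)]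
  · refine Finset.prod_congr rfl fun χ hχ => ?_
    rw [if_neg]
    intro h'
    exact Finset.ne_of_mem_erase hχ (Subtype.ext h')

lemma det_N (p r : ℕ) [Fact p.Prime] (hpr : p = 2 * r + 1) (hr : 0 < r) :
    |(Nmat p r).det| = 2 * r * evenProd p := by
  have hp : p.Prime := Fact.out
  let z : Fin r := ⟨0, hr⟩
  have hlog : 0 < Real.log p := Real.log_pos (by exact_mod_cast hp.one_lt)
  have hz : ∀ i : Fin r, (i:ℕ) = 0 ↔ i = z := fun i => by simp [z, Fin.ext_iff]
  have hA : (Amat p r).det = ((Nmat p r).updateRow z (Amat p r z)).det := by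
    refine Matrix.det_eq_of_forall_row_eq_smul_add_const (fun i => if i = z then 0 else 1) z (by simp) ?_
    intro i j
    by_cases hi : i = z
    · subst hi; simp
    · rw [Matrix.updateRow_ne hi, Matrix.updateRow_self, if_neg hi]
      simp only [Amat, Nmat, Matrix.of_apply, hz, if_neg hi]
      simp only [z, zero_add, Nat.cast_one, one_mul]
      ring
  have hzero : ((Nmat p r).updateRow z (Real.log p • Nmat p r z + (-(2 * r : ℝ)) • Amat p r z)).det = 0 := by
    rw [← Matrix.exists_mulVec_eq_zero_iff]
    refine ⟨fun _ => 1, ?_, ?_⟩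
    · intro h
      have := congrFun h z
      simp at this
    · have hsum1 := sum_lam_half p r hpr z
      ext i
      simp only [Matrix.mulVec, dotProduct, mul_one, Pi.zero_apply]
      by_cases hi : i = z
      · subst hi
        simp only [Matrix.updateRow_self, Pi.add_apply, Pi.smul_apply, smul_eq_mul, Finset.sum_add_distrib, ← Finset.mul_sum]
        have e1 : ∑ j, Amat p r z j = Real.log p := hsum1
        have e2 : ∑ j, Nmat p r z j = 2 * r := by
          simp [Nmat, z]; ring
        rw [e1, e2]; ring
      · rw [Matrix.updateRow_ne hi]
        have e3 : ∀ j, Nmat p r i j = 2 * lam p ((((i:ℕ)+1:ℕ) : ZMod p) * (((j:ℕ)+1:ℕ) : ZMod p)) -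
            2 * lam p (((((z:Fin r):ℕ)+1:ℕ) : ZMod p) * (((j:ℕ)+1:ℕ) : ZMod p)) := by
          intro j
          simp only [Nmat, Matrix.of_apply, hz, if_neg hi]
          simp only [z, zero_add, Nat.cast_one, one_mul]
          ring
        simp only [e3, Finset.sum_sub_distrib, sum_lam_half p r hpr i, hsum1, sub_self]
  rw [Matrix.det_updateRow_add, Matrix.det_updateRow_smul, Matrix.det_updateRow_smul, ← hA, Matrix.updateRow_eq_self] at hzero
  have h2 : Real.log p * (Nmat p r).det = 2 * r * (Amat p r).det := by linarith
  have h3 := congrArg abs h2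
  rw [abs_mul, abs_mul, det_A p r hpr hr, abs_of_pos hlog, abs_of_nonneg (show (0:ℝ) ≤ 2 * r by positivity)] at h3
  apply mul_left_cancel₀ hlog.ne'
  rw [h3]; ring

end Stmt16


namespace Stmt16

lemma places (K : Type) [Field K] [NumberField K] (p r : ℕ) [Fact p.Prime]
    [IsCyclotomicExtension {p} ℚ K] (hpr : p = 2 * r + 1) (hr : 0 < r)
    (ζ : K) (hζ : IsPrimitiveRoot ζ p) :
    ∃ ι : Fin r ≃ InfinitePlace K, ∀ (j : Fin r) (a : ℕ),
      ι j (1 - ζ ^ a) = ‖1 - (ZMod.stdAddChar ((a : ZMod p) * (((j : ℕ) + 1 : ℕ) : ZMod p)) : ℂ)‖ := by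
  have hp : p.Prime := Fact.out
  have hp2 : 2 < p := by omega
  have hirr : Irreducible (cyclotomic p ℚ) := cyclotomic.irreducible_rat hp.pos
  have hinj := ZMod.injective_stdAddChar (N := p)
  have hval : ∀ j : Fin r, (((j : ℕ) + 1 : ℕ) : ZMod p) ≠ 0 := by
    intro j h
    rw [ZMod.natCast_eq_zero_iff] at h
    have := Nat.le_of_dvd (by omega) h
    omega
  have hprim : ∀ j : Fin r, (ZMod.stdAddChar (((j : ℕ) + 1 : ℕ) : ZMod p) : ℂ) ∈ primitiveRoots p ℂ := by
    intro j
    rw [mem_primitiveRoots hp.pos]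
    refine (IsPrimitiveRoot.iff_orderOf).2 (orderOf_eq_prime ?_ ?_)
    · rw [← AddChar.map_nsmul_eq_pow]; simp
    · intro h
      apply hval j
      apply hinj
      rw [h, AddChar.map_zero_eq_one]
  let φ : Fin r → (K →ₐ[ℚ] ℂ) := fun j => (hζ.embeddingsEquivPrimitiveRoots ℂ hirr).symm ⟨_, hprim j⟩
  have hφ : ∀ j, φ j ζ = ZMod.stdAddChar (((j : ℕ) + 1 : ℕ) : ZMod p) := by
    intro j
    rw [← hζ.embeddingsEquivPrimitiveRoots_apply_coe ℂ hirr]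
    simp [φ]
  let f : Fin r → InfinitePlace K := fun j => InfinitePlace.mk (φ j : K →+* ℂ)
  have hf : Function.Bijective f := by
    rw [Fintype.bijective_iff_injective_and_card]
    constructor
    · intro j k hjk
      have h := (InfinitePlace.mk_eq_iff).1 hjk
      rcases h with h | h
      · have h2 := congrArg (fun g : K →+* ℂ => g ζ) h
        simp only [RingHom.coe_coe, hφ] at h2
        have h3 := hinj h2
        rw [ZMod.natCast_eq_natCast_iff'] at h3
        rw [Nat.mod_eq_of_lt (by omega), Nat.mod_eq_of_lt (by omega)] at h3
        exact Fin.ext (by omega)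
      · have h2 := congrArg (fun g : K →+* ℂ => g ζ) h
        simp only [ComplexEmbedding.conjugate_coe_eq, RingHom.coe_coe, hφ] at h2
        rw [← AddChar.map_neg_eq_conj] at h2
        have h3 := hinj h2
        exfalso
        have h4 : (((k : ℕ) + 1 + (j + 1) : ℕ) : ZMod p) = 0 := by
          rw [Nat.cast_add, ← h3]; simp
        rw [ZMod.natCast_eq_zero_iff] at h4
        have := Nat.le_of_dvd (by omega) h4
        omega
    · rw [Fintype.card_fin, InfinitePlace.card_eq_nrRealPlaces_add_nrComplexPlaces,
        IsCyclotomicExtension.Rat.nrRealPlaces_eq_zero (n := p) K hp2,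
        IsCyclotomicExtension.Rat.nrComplexPlaces_eq_totient_div_two p K, Nat.totient_prime hp]
      omega
  refine ⟨Equiv.ofBijective f hf, fun j a => ?_⟩
  change (InfinitePlace.mk (φ j : K →+* ℂ)) (1 - ζ ^ a) = _
  rw [InfinitePlace.apply]
  simp only [RingHom.coe_coe, map_sub, map_one, map_pow, hφ]
  rw [← AddChar.map_nsmul_eq_pow, nsmul_eq_mul]

lemma one_sub_ne (K : Type) [Field K] (p : ℕ) (ζ : K) (hζ : IsPrimitiveRoot ζ p) (a : ℕ)
    (h0 : 0 < a) (h1 : a < p) : 1 - ζ ^ a ≠ 0 := by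
  rw [sub_ne_zero]
  exact (hζ.pow_ne_one_of_pos_of_lt h0.ne' h1).symm

lemma exists_units (K : Type) [Field K] [NumberField K] (p : ℕ) [Fact p.Prime]
    (ζ : K) (hζ : IsPrimitiveRoot ζ p) :
    ∃ c : ℕ → (𝓞 K)ˣ, ∀ a, 0 < a → a < p → ((c a : 𝓞 K) : K) * (1 - ζ) = 1 - ζ ^ a := by
  have hp : p.Prime := Fact.out
  have : NeZero p := ⟨hp.ne_zero⟩
  have key : ∀ a, ∃ u : (𝓞 K)ˣ, 0 < a → a < p → ((u : 𝓞 K) : K) * (1 - ζ) = 1 - ζ ^ a := by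
    intro a
    by_cases ha : 0 < a ∧ a < p
    · have hcop : a.Coprime p := ((Nat.coprime_comm.1 ((Nat.Prime.coprime_iff_not_dvd hp).2 (Nat.not_dvd_of_pos_of_lt ha.1 ha.2))))
      obtain ⟨u, hu⟩ := hζ.toInteger_isPrimitiveRoot.associated_sub_one_pow_sub_one_of_coprime hcop
      refine ⟨u, fun _ _ => ?_⟩
      have h := congrArg (algebraMap (𝓞 K) K) hu
      simp only [map_mul, map_sub, map_pow, map_one] at h
      have hz : algebraMap (𝓞 K) K hζ.toInteger = ζ := rfl
      rw [hz] at h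
      linear_combination -h
    · exact ⟨1, fun h1 h2 => absurd ⟨h1, h2⟩ ha⟩
  choose c hc using key
  exact ⟨c, hc⟩

lemma reg_cyc (K : Type) [Field K] [NumberField K] (p r : ℕ) [Fact p.Prime]
    [IsCyclotomicExtension {p} ℚ K] (hpr : p = 2 * r + 1) (hr : 0 < r)
    (ζ : K) (hζ : IsPrimitiveRoot ζ p) (c : ℕ → (𝓞 K)ˣ)
    (hc : ∀ a, 0 < a → a < p → ((c a : 𝓞 K) : K) * (1 - ζ) = 1 - ζ ^ a) :
    ∃ e : {j : Fin r // (j : ℕ) ≠ 0} ≃ Fin (Units.rank K),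
      Units.regOfFamily (fun k => c (((e.symm k).1 : ℕ) + 1)) = evenProd p := by
  classical
  have hp : p.Prime := Fact.out
  have hp2 : 2 < p := by omega
  obtain ⟨ι, hι⟩ := places K p r hpr hr ζ hζ
  have := IsCyclotomicExtension.Rat.isTotallyComplex (n := p) K hp2
  let z : Fin r := ⟨0, hr⟩
  have hz : ∀ j : Fin r, (j : ℕ) ≠ 0 ↔ j ≠ z := by
    intro j; simp [z, Fin.ext_iff]
  have hcardr : Fintype.card (InfinitePlace K) = r := by
    rw [← Fintype.card_congr ι, Fintype.card_fin]
  have hrank : Units.rank K = r - 1 := by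
    unfold Units.rank; rw [hcardr]
  have hcard : Fintype.card {j : Fin r // (j : ℕ) ≠ 0} = Fintype.card (Fin (Units.rank K)) := by
    rw [Fintype.card_fin, hrank, Fintype.card_congr (Equiv.subtypeEquivRight hz),
      Fintype.card_subtype_compl, Fintype.card_fin, Fintype.card_subtype_eq]
  let e := Fintype.equivOfCardEq hcard
  refine ⟨e, ?_⟩
  let e' : {w : InfinitePlace K // w ≠ ι z} ≃ {j : Fin r // (j : ℕ) ≠ 0} :=
    ι.symm.subtypeEquiv (by
      intro w
      rw [hz]
      simp [Equiv.symm_apply_eq])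
  have hdet := Units.finrank_mul_regOfFamily_eq_det (fun k => c (((e.symm k).1 : ℕ) + 1)) (ι z) (e'.trans e)
  rw [← Matrix.det_submatrix_equiv_self ι] at hdet
  have hN : (Matrix.of (fun i w : InfinitePlace K ↦
        if h : i = ι z then (w.mult : ℝ) else w.mult * (w ((c (((e.symm ((e'.trans e) ⟨i, h⟩)).1 : ℕ) + 1) : 𝓞 K) : K)).log)).submatrix ι ι = Nmat p r := by
    ext i j
    simp only [Matrix.submatrix_apply, Matrix.of_apply, Nmat, IsTotallyComplex.mult_eq]
    by_cases hi : (i : ℕ) = 0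
    · have : i = z := Fin.ext hi
      subst this
      simp [z]
    · have hi' : ι i ≠ ι z := fun h => hi (by rw [ι.injective h])
      rw [dif_neg hi', if_neg hi]
      have he : (e.symm ((e'.trans e) ⟨ι i, hi'⟩)).1 = i := by simp [e']
      rw [he]
      have h1 := congrArg (ι j) (hc ((i : ℕ) + 1) (by omega) (by omega))
      have h2 := hι j 1
      rw [pow_one, Nat.cast_one, one_mul] at h2
      rw [map_mul, hι, h2] at h1
      have hne : ‖1 - (ZMod.stdAddChar (((j : ℕ) + 1 : ℕ) : ZMod p) : ℂ)‖ ≠ 0 := by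
        rw [← h2]
        have := one_sub_ne K p ζ hζ 1 one_pos hp.one_lt
        rw [pow_one] at this
        exact (map_ne_zero (ι j)).2 this
      have hne2 : (ι j) ((c ((i : ℕ) + 1) : 𝓞 K) : K) ≠ 0 :=
        (map_ne_zero (ι j)).2 (by simp)
      have h3 := congrArg Real.log h1
      rw [Real.log_mul hne2 hne] at h3
      simp only [lam]
      rw [← h3]
      push_cast
      ring
  rw [hN, det_N p r hpr hr, IsCyclotomicExtension.finrank K (cyclotomic.irreducible_rat hp.pos), Nat.totient_prime hp] at hdet
  have h5 : ((p - 1 : ℕ) : ℝ) = 2 * r := by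
    rw [show p - 1 = 2 * r by omega]; push_cast; ring
  rw [h5] at hdet
  have h6 : (2 * r : ℝ) ≠ 0 := by positivity
  exact mul_left_cancel₀ h6 hdet

end Stmt16


namespace Stmt16

lemma sum_Icc_half {M : Type*} [AddCommMonoid M] (r : ℕ) (f : ℕ → M) :
    ∑ a ∈ Finset.Icc 1 (2 * r), f a = ∑ j : Fin r, (f ((j : ℕ) + 1) + f (2 * r + 1 - ((j : ℕ) + 1))) := by
  rw [Fin.sum_univ_eq_sum_range (fun j => f (j + 1) + f (2 * r + 1 - (j + 1))) r]
  have h1 : ∑ a ∈ Finset.Icc 1 (2 * r), f a = ∑ k ∈ Finset.range (r + r), f (k + 1) := by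
    rw [← two_mul]
    refine Finset.sum_nbij' (fun a => a - 1) (fun k => k + 1) ?_ ?_ ?_ ?_ ?_
    · intro a ha; simp only [Finset.mem_Icc, Finset.mem_range] at *; omega
    · intro a ha; simp only [Finset.mem_Icc, Finset.mem_range] at *; omega
    · intro a ha; simp only [Finset.mem_Icc] at *; omega
    · intro a ha; simp
    · intro a ha; simp only [Finset.mem_Icc] at *; congr 1; omega
  rw [h1, Finset.sum_range_add, Finset.sum_add_distrib]
  congr 1
  rw [← Finset.sum_range_reflect]
  apply Finset.sum_congr rfl
  intro k hk
  rw [Finset.mem_range] at hk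
  congr 1
  omega

/-- Power sums are divisible by `p`. -/
lemma dvd_powsum (p : ℕ) [Fact p.Prime] (i : ℕ) (hi0 : 0 < i) (hi : i < p - 1) :
    p ∣ ∑ a ∈ Finset.Icc 1 (p - 1), a ^ i := by
  have hp : p.Prime := Fact.out
  rw [← ZMod.natCast_eq_zero_iff]
  push_cast
  have h := FiniteField.sum_pow_lt_card_sub_one (ZMod p) i (by rwa [ZMod.card])
  have h1 : ∑ c : ZMod p, c ^ i = ∑ k ∈ Finset.range p, (k : ZMod p) ^ i := by
    refine Finset.sum_nbij' (fun c => c.val) (fun k => (k : ZMod p)) ?_ ?_ ?_ ?_ ?_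
    · intro c _; exact Finset.mem_range.mpr (ZMod.val_lt c)
    · intro k _; exact Finset.mem_univ _
    · intro c _; simp
    · intro k hk; exact ZMod.val_cast_of_lt (Finset.mem_range.mp hk)
    · intro c _; simp
  rw [← h, h1]
  apply Finset.sum_subset
  · intro a ha
    simp only [Finset.mem_Icc, Finset.mem_range] at *
    have := hp.pos
    omega
  · intro a ha hb
    simp only [Finset.mem_Icc, Finset.mem_range] at *
    have : a = 0 := by omega
    subst this
    simp [Nat.pos_iff_ne_zero.1 hi0]

/-- Logarithmic embedding of a unit. -/
noncomputable abbrev Lg (K : Type) [Field K] [NumberField K] (u : (𝓞 K)ˣ) : Units.dirichletUnitTheorem.logSpace K :=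
  Units.logEmbedding K (Additive.ofMul u)

section
variable {K : Type} [Field K] [NumberField K]

lemma Lg_mul (u v : (𝓞 K)ˣ) : Lg K (u * v) = Lg K u + Lg K v := by simp [Lg]
lemma Lg_inv (u : (𝓞 K)ˣ) : Lg K u⁻¹ = - Lg K u := by simp [Lg]
lemma Lg_one : Lg K 1 = 0 := by simp [Lg]
lemma Lg_pow (u : (𝓞 K)ˣ) (n : ℕ) : Lg K (u ^ n) = (n : ℝ) • Lg K u := by
  rw [Nat.cast_smul_eq_nsmul]; simp [Lg]
lemma Lg_prod {ι : Type*} (s : Finset ι) (f : ι → (𝓞 K)ˣ) :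
    Lg K (∏ a ∈ s, f a) = ∑ a ∈ s, Lg K (f a) := by
  classical
  induction s using Finset.induction_on with
  | empty => simp [Lg_one]
  | insert a s ha ih => rw [Finset.prod_insert ha, Finset.sum_insert ha, Lg_mul, ih]

lemma Lg_tors (u : (𝓞 K)ˣ) (hu : u ∈ Units.torsion K) : Lg K u = 0 :=
  Units.dirichletUnitTheorem.logEmbedding_eq_zero_iff.2 hu

lemma span_of_mem {n : ℕ} (u : Fin n → (𝓞 K)ˣ) (s : (𝓞 K)ˣ)
    (hs : s ∈ Subgroup.closure (Set.range u) ⊔ Units.torsion K) :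
    ∃ k : Fin n → ℤ, Lg K s = ∑ l, (k l : ℝ) • Lg K (u l) := by
  classical
  obtain ⟨y, hy, t, ht, rfl⟩ := Subgroup.mem_sup.1 hs
  have key : ∃ k : Fin n → ℤ, Lg K y = ∑ l, (k l : ℝ) • Lg K (u l) := by
    clear hs
    induction hy using Subgroup.closure_induction with
    | mem x hx =>
      obtain ⟨j, rfl⟩ := hx
      refine ⟨Pi.single j 1, ?_⟩
      rw [Finset.sum_eq_single j]
      · simp
      · intro b _ hb; simp [hb]
      · simp
    | one => exact ⟨0, by simp [Lg_one]⟩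
    | mul x z _ _ hx hz =>
      obtain ⟨k1, h1⟩ := hx
      obtain ⟨k2, h2⟩ := hz
      refine ⟨k1 + k2, ?_⟩
      rw [Lg_mul, h1, h2, ← Finset.sum_add_distrib]
      exact Finset.sum_congr rfl fun l _ => by simp [add_smul]
    | inv x _ hx =>
      obtain ⟨k1, h1⟩ := hx
      refine ⟨-k1, ?_⟩
      rw [Lg_inv, h1, ← Finset.sum_neg_distrib]
      exact Finset.sum_congr rfl fun l _ => by simp
  obtain ⟨k, hk⟩ := key
  exact ⟨k, by rw [Lg_mul, Lg_tors t ht, add_zero, hk]⟩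

/-- `c_a` and `c_{p-a}` have the same logarithms. -/
lemma Lg_symm (p : ℕ) [Fact p.Prime] (ζ : K) (hζ : IsPrimitiveRoot ζ p) (c : ℕ → (𝓞 K)ˣ)
    (hc : ∀ a, 0 < a → a < p → ((c a : 𝓞 K) : K) * (1 - ζ) = 1 - ζ ^ a)
    (a : ℕ) (h0 : 0 < a) (h1 : a < p) : Lg K (c (p - a)) = Lg K (c a) := by
  have hp : p.Prime := Fact.out
  have hne : (1 - ζ) ≠ 0 := by
    have := one_sub_ne K p ζ hζ 1 one_pos hp.one_lt
    rwa [pow_one] at this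
  have e1 := hc a h0 h1
  have e2 := hc (p - a) (by omega) (by omega)
  have e3 : ζ ^ (p - a) * ζ ^ a = 1 := by
    rw [← pow_add, Nat.sub_add_cancel h1.le, hζ.pow_eq_one]
  have e4 : ((c (p - a) : 𝓞 K) : K) * ζ ^ a = - ((c a : 𝓞 K) : K) := by
    apply mul_right_cancel₀ hne
    linear_combination ζ ^ a * e2 + e1 - e3
  have e5 : ((c (p - a) : 𝓞 K) : K) ^ (2 * p) = ((c a : 𝓞 K) : K) ^ (2 * p) := by
    have h := congrArg (fun t => t ^ (2 * p)) e4
    simp only [mul_pow] at h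
    rw [← pow_mul ζ, show a * (2 * p) = p * (2 * a) by ring, pow_mul ζ, hζ.pow_eq_one, one_pow, mul_one,
      Even.neg_pow (even_two_mul p)] at h
    exact h
  have e6 : c (p - a) ^ (2 * p) = c a ^ (2 * p) := by
    ext
    push_cast
    exact e5
  have e7 := congrArg (Lg K) e6
  rw [Lg_pow, Lg_pow] at e7
  have : ((2 * p : ℕ) : ℝ) ≠ 0 := by
    have := hp.pos
    positivity
  exact smul_right_injective _ this e7

/-- From a `p`-th root of `θ` we get a unit. -/
lemma exists_unit_root (p : ℕ) [Fact p.Prime] (ζ : K) (hζ : IsPrimitiveRoot ζ p) (c : ℕ → (𝓞 K)ˣ)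
    (hc : ∀ a, 0 < a → a < p → ((c a : 𝓞 K) : K) * (1 - ζ) = 1 - ζ ^ a)
    (i : ℕ) (hi0 : 0 < i) (hi : i < p - 1) (x : K)
    (hx : x ^ p = ∏ a ∈ Finset.Icc 1 (p - 1), (1 - ζ ^ a) ^ (a ^ i)) :
    ∃ y : (𝓞 K)ˣ, y ^ p = ∏ a ∈ Finset.Icc 1 (p - 1), c a ^ (a ^ i) := by
  have hp : p.Prime := Fact.out
  have hne : (1 - ζ) ≠ 0 := by
    have := one_sub_ne K p ζ hζ 1 one_pos hp.one_lt
    rwa [pow_one] at this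
  obtain ⟨m, hm⟩ := dvd_powsum p i hi0 hi
  set C := ∏ a ∈ Finset.Icc 1 (p - 1), c a ^ (a ^ i) with hC
  have hCK : ((C : 𝓞 K) : K) = ∏ a ∈ Finset.Icc 1 (p - 1), ((c a : 𝓞 K) : K) ^ (a ^ i) := by
    rw [hC]; push_cast; simp
  have h1 : x ^ p = ((C : 𝓞 K) : K) * (1 - ζ) ^ (p * m) := by
    rw [hx, hCK, ← hm, ← Finset.prod_pow_eq_pow_sum, ← Finset.prod_mul_distrib]
    apply Finset.prod_congr rfl
    intro a ha
    rw [Finset.mem_Icc] at ha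
    rw [← mul_pow, hc a (by omega) (by have := hp.pos; omega)]
  have h2 : (x / (1 - ζ) ^ m) ^ p = ((C : 𝓞 K) : K) := by
    rw [div_pow, ← pow_mul, mul_comm m p, h1, mul_div_assoc, div_self (pow_ne_zero _ hne), mul_one]
  have h3 : IsIntegral ℤ (x / (1 - ζ) ^ m) := by
    apply IsIntegral.of_pow hp.pos
    rw [h2]
    exact RingOfIntegers.isIntegral_coe _
  let Y : 𝓞 K := ⟨x / (1 - ζ) ^ m, h3⟩
  have h4 : Y ^ p = (C : 𝓞 K) := by
    apply RingOfIntegers.ext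
    push_cast
    exact h2
  have h5 : IsUnit Y := (isUnit_pow_iff hp.ne_zero).1 (h4 ▸ C.isUnit)
  refine ⟨h5.unit, ?_⟩
  ext1
  rw [Units.val_pow_eq_pow_val, IsUnit.unit_spec, h4]

lemma index_lemma (p r : ℕ) [Fact p.Prime] [IsCyclotomicExtension {p} ℚ K]
    (hpr : p = 2 * r + 1) (hr : 0 < r) (hreg : ¬ p ∣ classNumber K)
    (u : Fin (Units.rank K) → (𝓞 K)ˣ) (hu : Units.regOfFamily u = evenProd p) :
    Units.IsMaxRank u ∧ ¬ p ∣ (Subgroup.closure (Set.range u) ⊔ Units.torsion K).index := by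
  have hp : p.Prime := Fact.out
  obtain ⟨m, hm⟩ := class_formula K p r hpr hr
  have hR := Units.regulator_ne_zero K
  have hdiv := Units.regOfFamily_div_regulator u
  set I := (Subgroup.closure (Set.range u) ⊔ Units.torsion K).index
  rw [div_eq_iff hR] at hdiv
  rw [← hu, hdiv] at hm
  have h1 : ((2 ^ (r - 1) * classNumber K : ℕ) : ℝ) = ((m * I : ℕ) : ℝ) := by
    push_cast
    apply mul_right_cancel₀ hR
    linear_combination hm
  have h2 : 2 ^ (r - 1) * classNumber K = m * I := by exact_mod_cast h1
  have h3 : ¬ p ∣ I := by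
    intro h
    have h4 : p ∣ 2 ^ (r - 1) * classNumber K := h2 ▸ h.mul_left m
    rcases hp.dvd_mul.1 h4 with h5 | h5
    · have := Nat.le_of_dvd two_pos (hp.dvd_of_dvd_pow h5)
      omega
    · exact hreg h5
  refine ⟨Units.regOfFamily_ne_zero_iff.1 ?_, h3⟩
  rw [hdiv]
  refine mul_ne_zero ?_ hR
  intro h
  apply h3
  rw [Nat.cast_eq_zero.1 h]
  exact dvd_zero p

lemma not_dvd_e (p : ℕ) [Fact p.Prime] (hp5 : 5 ≤ p) (i : ℕ) (hi : Even i) :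
    ¬ p ∣ 2 ^ i + (p - 2) ^ i := by
  have hp : p.Prime := Fact.out
  intro h
  rw [← ZMod.natCast_eq_zero_iff] at h
  push_cast [Nat.cast_sub (show 2 ≤ p by omega)] at h
  rw [ZMod.natCast_self, zero_sub, hi.neg_pow, ← two_mul, ← pow_succ'] at h
  have h2 : ((2 ^ (i + 1) : ℕ) : ZMod p) = 0 := by push_cast; exact h
  rw [ZMod.natCast_eq_zero_iff] at h2
  have := Nat.le_of_dvd two_pos (hp.dvd_of_dvd_pow h2)
  omega

end

theorem main (p : ℕ) (hp : p.Prime) (hpodd : Odd p)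
    (K : Type) [Field K] [NumberField K]
    (ζ : K) (hζ : IsPrimitiveRoot ζ p)
    (hKgen : Algebra.adjoin ℚ {ζ} = (⊤ : Subalgebra ℚ K))
    (hreg : ¬ p ∣ Nat.card (ClassGroup (𝓞 K)))
    (i : ℕ) (hieven : Even i) (hi2 : 2 ≤ i) (hi3 : i ≤ p - 3) :
    ∀ x : K, x ^ p ≠ ∏ a ∈ Finset.Icc 1 (p - 1), (1 - ζ ^ a) ^ (a ^ i) := by
  intro x hx
  have hF : Fact p.Prime := ⟨hp⟩
  have hp5 : 5 ≤ p := by omega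
  obtain ⟨r, hpr⟩ := hpodd
  have hr : 0 < r := by omega
  have hcyc : IsCyclotomicExtension {p} ℚ K := by
    rw [IsCyclotomicExtension.iff_adjoin_eq_top]
    constructor
    · rintro n hn _
      rw [Set.mem_singleton_iff] at hn
      subst hn
      exact ⟨ζ, hζ⟩
    · rw [eq_top_iff, ← hKgen]
      apply Algebra.adjoin_mono
      rw [Set.singleton_subset_iff]
      exact ⟨p, rfl, hp.ne_zero, hζ.pow_eq_one⟩
  obtain ⟨c, hc⟩ := exists_units K p ζ hζ
  obtain ⟨e, he⟩ := reg_cyc K p r hpr hr ζ hζ c hc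
  have hcl : ¬ p ∣ classNumber K := by
    rwa [classNumber, ← Nat.card_eq_fintype_card]
  obtain ⟨hmax, hI⟩ := index_lemma p r hpr hr hcl _ he
  obtain ⟨y, hy⟩ := exists_unit_root p ζ hζ c hc i (by omega) (by omega) x hx
  obtain ⟨n, hn⟩ := span_of_mem (K := K) (fun k => c (((e.symm k).1 : ℕ) + 1)) _
    (Subgroup.pow_index_mem (Subgroup.closure (Set.range fun k => c (((e.symm k).1 : ℕ) + 1)) ⊔ Units.torsion K) y)
  set I := (Subgroup.closure (Set.range fun k => c (((e.symm k).1 : ℕ) + 1)) ⊔ Units.torsion K).index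
  have hc1 : c 1 = 1 := by
    have hne : (1 - ζ) ≠ 0 := by
      have := one_sub_ne K p ζ hζ 1 one_pos hp.one_lt
      rwa [pow_one] at this
    have h := hc 1 one_pos hp.one_lt
    rw [pow_one] at h
    have h' : ((c 1 : 𝓞 K) : K) = 1 := mul_right_cancel₀ hne (by rw [h, one_mul])
    ext
    rw [h']; simp
  let E : ℕ → ℕ := fun a => a ^ i + (p - a) ^ i
  -- logarithm of the relation
  have hlog : (p : ℝ) • Lg K y = ∑ k, (E (((e.symm k).1 : ℕ) + 1) : ℝ) • Lg K (c (((e.symm k).1 : ℕ) + 1)) := by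
    rw [← Lg_pow, hy, Lg_prod, show p - 1 = 2 * r by omega, sum_Icc_half,
      e.symm.sum_comp (fun j => (E ((j.1 : ℕ) + 1) : ℝ) • Lg K (c ((j.1 : ℕ) + 1)))]
    have hs : ∀ j : Fin r, Lg K (c ((j : ℕ) + 1) ^ ((j : ℕ) + 1) ^ i) +
        Lg K (c (2 * r + 1 - ((j : ℕ) + 1)) ^ (2 * r + 1 - ((j : ℕ) + 1)) ^ i) =
        (E ((j : ℕ) + 1) : ℝ) • Lg K (c ((j : ℕ) + 1)) := by
      intro j
      rw [← hpr, Lg_pow, Lg_pow, Lg_symm p ζ hζ c hc _ (by omega) (by omega), ← add_smul]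
      simp only [E, Nat.cast_add]
    rw [Finset.sum_congr rfl fun j _ => hs j]
    symm
    rw [← Finset.sum_subtype (Finset.univ.filter fun j : Fin r => (j : ℕ) ≠ 0) (by simp)
      (fun j : Fin r => (E ((j : ℕ) + 1) : ℝ) • Lg K (c ((j : ℕ) + 1)))]
    apply Finset.sum_filter_of_ne
    intro j _ hj h0
    apply hj
    rw [h0, zero_add, hc1, Lg_one, smul_zero]
  have hcmp : ∑ k, ((p * n k - I * E (((e.symm k).1 : ℕ) + 1) : ℤ) : ℝ) • Lg K (c (((e.symm k).1 : ℕ) + 1)) = 0 := by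
    have h1 : (p : ℝ) • ((I : ℝ) • Lg K y) = (I : ℝ) • ((p : ℝ) • Lg K y) := smul_comm _ _ _
    rw [hlog, ← Lg_pow, hn, Finset.smul_sum, Finset.smul_sum, ← sub_eq_zero, ← Finset.sum_sub_distrib] at h1
    rw [← h1]
    apply Finset.sum_congr rfl
    intro k _
    rw [smul_smul, smul_smul, ← sub_smul]
    push_cast
    rfl
  let j2 : {j : Fin r // (j : ℕ) ≠ 0} := ⟨⟨1, by omega⟩, one_ne_zero⟩
  have hk := Fintype.linearIndependent_iff.1 hmax _ hcmp (e j2)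
  rw [e.symm_apply_apply] at hk
  have hk2 : (p : ℤ) * n (e j2) = ((I * E 2 : ℕ) : ℤ) := by
    have : (p * n (e j2) - I * E 2 : ℤ) = 0 := by exact_mod_cast hk
    push_cast
    linarith
  have hk3 : p ∣ I * E 2 := by
    rw [← Int.natCast_dvd_natCast, ← hk2]
    exact dvd_mul_right _ _
  rcases hp.dvd_mul.1 hk3 with h | h
  · exact hI h
  · exact not_dvd_e p hp5 i hieven h

end Stmt16

/-- Let `p` be a regular prime (odd, not dividing the class number of
`K = ℚ(ζ_p)`), and let `i` be an even integer with `2 ≤ i ≤ p-3`.  Then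
`θ = ∏_{a=1}^{p-1} (1 - ζ_p^a)^{a^i}` is not a `p`-th power in `K^×`. -/
theorem stmt16 (p : ℕ) (hp : p.Prime) (hpodd : Odd p)
    (K : Type) [Field K] [NumberField K]
    (ζ : K) (hζ : IsPrimitiveRoot ζ p)
    (hKgen : Algebra.adjoin ℚ {ζ} = (⊤ : Subalgebra ℚ K))
    (hreg : ¬ p ∣ Nat.card (ClassGroup (𝓞 K)))
    (i : ℕ) (hieven : Even i) (hi2 : 2 ≤ i) (hi3 : i ≤ p - 3) :
    ∀ x : K, x ^ p ≠ ∏ a ∈ Finset.Icc 1 (p - 1), (1 - ζ ^ a) ^ (a ^ i) := 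
  Stmt16.main p hp hpodd K ζ hζ hKgen hreg i hieven hi2 hi3
end

section
/- Let p be a prime and let 0 ≤ i ≤ p-1. Let G be a cyclic group of order p with generator g₀, and let M = F_p^{i+1} be the G-representation over F_p on which g₀ acts by the unipotent upper-triangular (i+1)×(i+1) matrix U with entries U_{s,t} = 1/((t-s)!) for s ≤ t and U_{s,t} = 0 for s > t (indices 1 ≤ s, t ≤ i+1); equivalently, g₀ acts by the exponential of the nilpotent Jordan block. Then the group cohomology H¹(G, M) is a 1-dimensional F_p-vector space when i < p-1, and H¹(G, M) = 0 when i = p-1. -/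
open groupCohomology

/-- In characteristic `p`, `1 + f + ⋯ + f^(p-1) = (f - 1)^(p-1)`. -/
lemma aux_geom (p : ℕ) [hp : Fact p.Prime] {V : Type*} [AddCommGroup V] [Module (ZMod p) V]
    (f : Module.End (ZMod p) V) :
    ∑ k ∈ Finset.range p, f ^ k = (f - 1) ^ (p - 1) := by
  have h : ∑ k ∈ Finset.range p, (Polynomial.X : Polynomial (ZMod p)) ^ k
      = (Polynomial.X - 1) ^ (p - 1) := by
    have hne : (Polynomial.X - 1 : Polynomial (ZMod p)) ≠ 0 := by
      simpa using Polynomial.X_sub_C_ne_zero (1 : ZMod p)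
    apply mul_right_cancel₀ hne
    rw [geom_sum_mul, ← pow_succ, Nat.sub_add_cancel hp.out.one_le, sub_pow_char, one_pow]
  have := congrArg (Polynomial.aeval f) h
  simpa using this

lemma aux_norm (p : ℕ) [hp : Fact p.Prime] {V : Type*} [AddCommGroup V] [Module (ZMod p) V]
    (ρ : Representation (ZMod p) (Multiplicative (ZMod p)) V)
    [Fintype (Multiplicative (ZMod p))] :
    ∑ g, ρ g = (ρ (Multiplicative.ofAdd 1) - 1) ^ (p - 1) := by
  rw [← aux_geom]
  symm
  refine Finset.sum_bij' (fun k _ => Multiplicative.ofAdd (k : ZMod p))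
    (fun g _ => (Multiplicative.toAdd g).val) ?_ ?_ ?_ ?_ ?_
  · simp
  · intro g _
    simpa using ZMod.val_lt _
  · intro k hk
    simpa using ZMod.val_cast_of_lt (Finset.mem_range.1 hk)
  · intro g _
    simp
  · intro k _
    rw [← map_pow, ← ofAdd_nsmul]
    simp

section mat
variable {F : Type*} [Field F] {i : ℕ} (N : Matrix (Fin (i + 1)) (Fin (i + 1)) F)

lemma aux_pow (h0 : ∀ s t : Fin (i + 1), (t : ℕ) < s + 1 → N s t = 0)
    (h1 : ∀ s t : Fin (i + 1), (t : ℕ) = s + 1 → N s t = 1) (k : ℕ) :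
    (∀ s t : Fin (i + 1), (t : ℕ) < s + k → (N ^ k) s t = 0) ∧
    (∀ s t : Fin (i + 1), (t : ℕ) = s + k → (N ^ k) s t = 1) := by
  induction k with
  | zero =>
    refine ⟨fun s t h => ?_, fun s t h => ?_⟩
    · rw [pow_zero, Matrix.one_apply_ne]
      rintro rfl
      omega
    · have : s = t := Fin.ext (by omega)
      rw [this]; simp
  | succ k ih =>
    refine ⟨fun s t h => ?_, fun s t h => ?_⟩
    · rw [pow_succ', Matrix.mul_apply]
      apply Finset.sum_eq_zero
      intro r _
      by_cases hr : (r : ℕ) < s + 1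
      · rw [h0 s r hr, zero_mul]
      · rw [ih.1 r t (by omega), mul_zero]
    · rw [pow_succ', Matrix.mul_apply]
      have ht := t.2
      rw [Finset.sum_eq_single (⟨s + 1, by omega⟩ : Fin (i + 1))]
      · rw [h1 _ _ rfl, ih.2 _ _ (by simp; omega), mul_one]
      · intro r _ hne
        have hne' : (r : ℕ) ≠ s + 1 := fun h => hne (Fin.ext h)
        by_cases hr : (r : ℕ) < s + 1
        · rw [h0 s r hr, zero_mul]
        · rw [ih.1 r t (by omega), mul_zero]
      · simp

lemma aux_last (h0 : ∀ s t : Fin (i + 1), (t : ℕ) < s + 1 → N s t = 0)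
    (v : Fin (i + 1) → F) : (N.mulVec v) (Fin.last i) = 0 := by
  rw [Matrix.mulVec, dotProduct]
  apply Finset.sum_eq_zero
  intro t _
  rw [h0, zero_mul]
  have := t.2
  simp
  omega

lemma aux_powzero (h0 : ∀ s t : Fin (i + 1), (t : ℕ) < s + 1 → N s t = 0)
    (h1 : ∀ s t : Fin (i + 1), (t : ℕ) = s + 1 → N s t = 1) : N ^ (i + 1) = 0 := by
  ext s t
  exact (aux_pow N h0 h1 (i + 1)).1 s t (by omega)

lemma aux_powlast (h0 : ∀ s t : Fin (i + 1), (t : ℕ) < s + 1 → N s t = 0)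
    (h1 : ∀ s t : Fin (i + 1), (t : ℕ) = s + 1 → N s t = 1) (v : Fin (i + 1) → F) :
    ((N ^ i).mulVec v) 0 = v (Fin.last i) := by
  rw [Matrix.mulVec, dotProduct, Finset.sum_eq_single (Fin.last i)]
  · rw [(aux_pow N h0 h1 i).2 _ _ (by simp), one_mul]
  · intro t _ hne
    have : (t : ℕ) ≠ i := fun h => hne (Fin.ext h)
    rw [(aux_pow N h0 h1 i).1 _ _ (by simp; omega), zero_mul]
  · simp

lemma aux_ker (h0 : ∀ s t : Fin (i + 1), (t : ℕ) < s + 1 → N s t = 0)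
    (h1 : ∀ s t : Fin (i + 1), (t : ℕ) = s + 1 → N s t = 1) (v : Fin (i + 1) → F)
    (hv : N.mulVec v = 0) (hv0 : v 0 = 0) : v = 0 := by
  have key : ∀ m : ℕ, ∀ j : Fin (i + 1), i - j < m → v j = 0 := by
    intro m
    induction m with
    | zero => intro j h; omega
    | succ m ih =>
      intro j hj
      by_cases hj0 : j = 0
      · rw [hj0, hv0]
      have hj1 : (j : ℕ) ≠ 0 := fun h => hj0 (Fin.ext h)
      have hj2 := j.2
      have := congrFun hv (⟨j - 1, by omega⟩ : Fin (i + 1))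
      rw [Matrix.mulVec, dotProduct, Finset.sum_eq_single j] at this
      · rw [h1 _ _ (by simp; omega), one_mul] at this
        exact this
      · intro t _ hne
        have hne' : (t : ℕ) ≠ j := fun h => hne (Fin.ext h)
        have ht := t.2
        by_cases hlt : (t : ℕ) < j
        · rw [h0 _ _ (by simp; omega), zero_mul]
        · rw [ih t (by omega), mul_zero]
      · simp
  ext j
  exact key (i + 1) j (by omega)

lemma aux_range (h0 : ∀ s t : Fin (i + 1), (t : ℕ) < s + 1 → N s t = 0)
    (h1 : ∀ s t : Fin (i + 1), (t : ℕ) = s + 1 → N s t = 1) :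
    LinearMap.range N.mulVecLin = LinearMap.ker (LinearMap.proj (R := F) (φ := fun _ => F)
      (Fin.last i)) := by
  apply Submodule.eq_of_le_of_finrank_le
  · rintro _ ⟨v, rfl⟩
    exact aux_last N h0 v
  · have e1 := LinearMap.finrank_range_add_finrank_ker N.mulVecLin
    have e2 := LinearMap.finrank_range_add_finrank_ker
      (LinearMap.proj (R := F) (φ := fun _ : Fin (i + 1) => F) (Fin.last i))
    rw [LinearMap.range_eq_top.2 (LinearMap.proj_surjective _), finrank_top] at e2
    have e3 : Module.finrank F (LinearMap.ker N.mulVecLin) ≤ Module.finrank F F := by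
      apply LinearMap.finrank_le_finrank_of_injective
        (f := (LinearMap.proj (R := F) (φ := fun _ : Fin (i + 1) => F) 0).comp
          (LinearMap.ker N.mulVecLin).subtype)
      rw [← LinearMap.ker_eq_bot, LinearMap.ker_eq_bot']
      rintro ⟨v, hv⟩ h
      exact Subtype.ext (aux_ker N h0 h1 v hv h)
    omega

end mat

theorem stmt17 (p : ℕ) (hp : p.Prime) (i : ℕ) (hi : i ≤ p - 1)
    (A : Rep (ZMod p) (Multiplicative (ZMod p)))
    (e : A ≃ₗ[ZMod p] (Fin (i + 1) → ZMod p))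
    (hact : ∀ v : A,
      e (A.ρ (Multiplicative.ofAdd (1 : ZMod p)) v) =
        (Matrix.of fun s t : Fin (i + 1) =>
            if (s : ℕ) ≤ (t : ℕ) then (((t : ℕ) - (s : ℕ)).factorial : ZMod p)⁻¹
            else 0).mulVec (e v)) :
    (i < p - 1 → Module.finrank (ZMod p) (groupCohomology.H1 A) = 1) ∧
    (i = p - 1 → ∀ x : groupCohomology.H1 A, x = 0) := by
  have : Fact p.Prime := ⟨hp⟩
  have : Fintype (Multiplicative (ZMod p)) := Fintype.ofFinite _
  set U : Matrix (Fin (i + 1)) (Fin (i + 1)) (ZMod p) := Matrix.of fun s t : Fin (i + 1) =>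
            if (s : ℕ) ≤ (t : ℕ) then (((t : ℕ) - (s : ℕ)).factorial : ZMod p)⁻¹
            else 0 with hU
  set N := U - 1 with hN
  have h0 : ∀ s t : Fin (i + 1), (t : ℕ) < s + 1 → N s t = 0 := by
    intro s t h
    by_cases hst : s = t
    · subst hst; simp [hN, hU]
    · have : (s : ℕ) ≠ t := fun h => hst (Fin.ext h)
      rw [hN, Matrix.sub_apply, Matrix.one_apply_ne hst, hU, Matrix.of_apply,
        if_neg (by omega), sub_zero]
  have h1 : ∀ s t : Fin (i + 1), (t : ℕ) = s + 1 → N s t = 1 := by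
    intro s t h
    have hst : s ≠ t := by rintro rfl; omega
    rw [hN, Matrix.sub_apply, Matrix.one_apply_ne hst, hU, Matrix.of_apply,
        if_pos (by omega), h]
    simp
  set g : Multiplicative (ZMod p) := Multiplicative.ofAdd (1 : ZMod p) with hg
  have hgen : ∀ x, x ∈ Subgroup.zpowers g := by
    intro x
    refine ⟨((Multiplicative.toAdd x).val : ℤ), ?_⟩
    simp only [zpow_natCast]
    rw [hg, ← ofAdd_nsmul]
    simp
  set D : Module.End (ZMod p) A := A.ρ g - 1 with hD
  have heD : ∀ v, e (D v) = N.mulVec (e v) := by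
    intro v
    rw [hD, LinearMap.sub_apply, map_sub, hact, hN, Matrix.sub_mulVec, Matrix.one_mulVec]
    rfl
  have heDk : ∀ k v, e ((D ^ k) v) = (N ^ k).mulVec (e v) := by
    intro k
    induction k with
    | zero => intro v; simp
    | succ k ih => intro v; rw [pow_succ', pow_succ', Module.End.mul_apply, heD, ih,
        Matrix.mulVec_mulVec]
  have hnorm : A.norm.hom.toLinearMap = D ^ (p - 1) := by
    rw [hD, ← aux_norm]
    rfl
  have hsub : (Rep.applyAsHom A g - CategoryTheory.CategoryStruct.id A).hom.toLinearMap = D := by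
    rfl
  have hrange : ∀ v, v ∈ LinearMap.range D ↔ e v (Fin.last i) = 0 := by
    intro v
    have hr := aux_range N h0 h1
    constructor
    · rintro ⟨w, rfl⟩
      rw [heD]; exact aux_last N h0 _
    · intro h
      have : e v ∈ LinearMap.range N.mulVecLin := by rw [hr]; exact h
      obtain ⟨w, hw⟩ := this
      refine ⟨e.symm w, e.injective ?_⟩
      rw [heD, e.apply_symm_apply]; exact hw
  have hodd : Odd 1 := odd_one
  set π := Rep.FiniteCyclicGroup.groupCohomologyπOdd A g hgen 1 hodd with hπ
  have hsurj : Function.Surjective π := by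
    rw [← ModuleCat.epi_iff_surjective]
    rw [hπ]
    unfold Rep.FiniteCyclicGroup.groupCohomologyπOdd
    refine @CategoryTheory.epi_comp _ _ _ _ _ _ ?_ _ ?_
    · have hiso : CategoryTheory.Epi
          (CategoryTheory.ShortComplex.moduleCatCyclesIso
            (Rep.FiniteCyclicGroup.subCompNormHom A g)).inv := inferInstance
      exact hiso
    · infer_instance
  have hzero : ∀ x, π x = 0 ↔ e x.1 (Fin.last i) = 0 := by
    intro x
    rw [hπ, Rep.FiniteCyclicGroup.groupCohomologyπOdd_eq_zero_iff, hsub, hrange]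
  constructor
  · intro hlt
    have hall : ∀ v : A, v ∈ LinearMap.ker A.norm.hom.toLinearMap := by
      intro v
      rw [hnorm, LinearMap.mem_ker]
      apply e.injective
      rw [heDk, map_zero, show p - 1 = (i + 1) + (p - 1 - (i + 1)) by omega, pow_add,
        aux_powzero N h0 h1, zero_mul, Matrix.zero_mulVec]
    let b : LinearMap.ker A.norm.hom.toLinearMap := ⟨e.symm (Pi.single (Fin.last i) 1), hall _⟩
    rw [finrank_eq_one_iff']
    refine ⟨π b, ?_, ?_⟩
    · rw [Ne, hzero]
      simp [b]
    · intro w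
      obtain ⟨x, rfl⟩ := hsurj w
      refine ⟨e x.1 (Fin.last i), ?_⟩
      rw [← map_smul, ← sub_eq_zero, ← map_sub, hzero]
      change e ((e x.1 (Fin.last i)) • e.symm (Pi.single (Fin.last i) 1) - x.1) (Fin.last i) = 0
      simp
  · intro heq x
    obtain ⟨y, rfl⟩ := hsurj x
    rw [hzero]
    have hy : (D ^ (p - 1)) y.1 = 0 := (LinearMap.congr_fun hnorm y.1).symm.trans y.2
    rw [← heq] at hy
    rw [← aux_powlast N h0 h1 (e y.1), ← heDk, hy]
    simp
end
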